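/- Let Y, T ⊂ P^r (r ≥ 3) be distinct integral curves with ⟨Y ∪ T⟩ = P^r. Then the set Σ(Y,T) of Segre points of the pair (Y,T) has dimension at most 1. If dim Σ(Y,T) = 1, then deg(Y) = deg(T), and every one-dimensional irreducible component D of the closure of Σ(Y,T) satisfies deg(D) = deg(Y); moreover Y, T, and D are pairwise birational. -/

import Mathlib

open MvPolynomial

noncomputable section

namespace EL

variable {k : Type} [Field k] {n : ℕ}

/-- Projective space of (vector) dimension `n` over `k`. -/
abbrev PS (k : Type) [Field k] (n : ℕ) : Type := Projectivization k (Fin n → k)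

/-- Projective vanishing set of a polynomial (intended to be homogeneous). -/
def V0 (f : MvPolynomial (Fin n) k) : Set (PS k n) :=
  {p | ∀ (v : Fin n → k) (hv : v ≠ 0), Projectivization.mk k v hv = p → eval v f = 0}

/-- The Zariski topology on projective space, generated by complements of vanishing
sets of homogeneous polynomials. -/
instance : TopologicalSpace (PS k n) :=
  TopologicalSpace.generateFrom
    {U | ∃ (d : ℕ) (f : MvPolynomial (Fin n) k), f.IsHomogeneous d ∧ U = (V0 f)ᶜ}

/-- The linear span (as a submodule of the cone) of a set of projective points. -/
def pspan (S : Set (PS k n)) : Submodule k (Fin n → k) := ⨆ p ∈ S, p.submodule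

/-- The projective linear subspace associated to a submodule. -/
def linSet (W : Submodule k (Fin n → k)) : Set (PS k n) := {p | p.submodule ≤ W}

/-- `q` lies in the projective span of `S`. -/
def memSpan (q : PS k n) (S : Set (PS k n)) : Prop := q.submodule ≤ pspan S

/-- The projective dimension of the span of `S`. -/
def spanDim (S : Set (PS k n)) : ℕ := Module.finrank k ↥(pspan S) - 1

/-- `S` is nondegenerate (spans the ambient projective space). -/
def Nondeg (S : Set (PS k n)) : Prop := pspan S = ⊤

/-- `S` is a projective linear subspace of projective dimension `d`. -/
def IsLin (S : Set (PS k n)) (d : ℕ) : Prop :=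
  ∃ W : Submodule k (Fin n → k), Module.finrank k ↥W = d + 1 ∧ S = linSet W

/-- Dimension of a subset, as topological Krull dimension. -/
def pdim (S : Set (PS k n)) : WithBot ℕ∞ := topologicalKrullDim ↥S

/-- An integral (sub)variety: an irreducible Zariski-closed set. -/
def IsVariety (S : Set (PS k n)) : Prop := IsClosed S ∧ IsIrreducible S

/-- A property holds for a general point of projective space. -/
def Generic (P : PS k n → Prop) : Prop :=
  ∃ U : Set (PS k n), IsOpen U ∧ Dense U ∧ ∀ q ∈ U, P q

/-- A property holds for a general point of the set `S`. -/
def GenericIn (S : Set (PS k n)) (P : PS k n → Prop) : Prop :=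
  ∃ U : Set (PS k n), IsOpen U ∧ S ⊆ closure (S ∩ U) ∧ ∀ q ∈ S ∩ U, P q

/-- A property holds for a general tuple of points of projective space. -/
def GenericP {ι : Type} (P : (ι → PS k n) → Prop) : Prop :=
  ∃ U : Set (ι → PS k n), IsOpen U ∧ Dense U ∧ ∀ z ∈ U, P z

/-- `q` is spanned by some `s` points of `X`. -/
def hasDecomp (X : Set (PS k n)) (q : PS k n) (s : ℕ) : Prop :=
  ∃ A : Finset (PS k n), ↑A ⊆ X ∧ A.card = s ∧ memSpan q ↑A

/-- The `X`-rank of a point `q`. -/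
def rk (X : Set (PS k n)) (q : PS k n) : ℕ := sInf {s | hasDecomp X q s}

/-- `A` irredundantly spans `q`. -/
def Irredundant (q : PS k n) (A : Finset (PS k n)) : Prop :=
  memSpan q ↑A ∧ ∀ B : Finset (PS k n), B ⊂ A → ¬ memSpan q ↑B

/-- The set `𝒮(X,q)` of minimal irredundant decompositions of `q` by points of `X`. -/
def decomps (X : Set (PS k n)) (q : PS k n) : Set (Finset (PS k n)) :=
  {A | ↑A ⊆ X ∧ A.card = rk X q ∧ Irredundant q A}

/-- The entry locus of `q` with respect to `X`. -/
def entryLocus (X : Set (PS k n)) (q : PS k n) : Set (PS k n) :=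
  closure (⋃ A ∈ decomps X q, (↑A : Set (PS k n)))

/-- The `s`-th secant variety of `X`. -/
def secant (X : Set (PS k n)) (s : ℕ) : Set (PS k n) :=
  closure {q | hasDecomp X q s}

/-- The generic `X`-rank: least `s` whose secant fills the span of `X`. -/
def rgen (X : Set (PS k n)) : ℕ := sInf {s | secant X s = linSet (pspan X)}

/-- Type I: the general entry locus is irreducible. -/
def TypeI (X : Set (PS k n)) : Prop := Generic (fun q => IsIrreducible (entryLocus X q))

/-- Type II: the general entry locus is reducible. -/
def TypeII (X : Set (PS k n)) : Prop := Generic (fun q => ¬ IsIrreducible (entryLocus X q))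

/-- Type A: the entry locus does not change at a general point of its span. -/
def TypeA (X : Set (PS k n)) : Prop :=
  Generic (fun q => GenericIn (linSet (pspan (entryLocus X q)))
    (fun o => entryLocus X o = entryLocus X q))

/-- `S` (of dimension `m`) has degree `d`: `d` is the largest finite number of points cut
on `S` by a linear subspace of complementary dimension. -/
def HasDegree (S : Set (PS k n)) (m d : ℕ) : Prop :=
  IsGreatest {t | ∃ L : Set (PS k n), IsLin L (n - 1 - m) ∧ (S ∩ L).Finite ∧
    (S ∩ L).ncard = t} d

/-- All secant varieties of `Y` (of dimension `m`) have the expected dimension. -/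
def NonDefective (Y : Set (PS k n)) (m : ℕ) : Prop :=
  ∀ s : ℕ, 1 ≤ s →
    pdim (secant Y s) = ((min ((m+1)*s - 1) (spanDim Y) : ℕ) : WithBot ℕ∞)

/-- `π_o(T) ⊆ π_o(Y)`: every point of `T` (other than `o`) is collinear with `o`
and a point of `Y`. -/
def projLE (o : PS k n) (T Y : Set (PS k n)) : Prop :=
  ∀ t ∈ T, t ≠ o → ∃ y ∈ Y, t.submodule ≤ o.submodule ⊔ y.submodule

/-- A Segre point of the pair `(Y,T)`: projection from `o` maps `Y` and `T`
onto the same set. -/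
def SegrePtPair (Y T : Set (PS k n)) (o : PS k n) : Prop :=
  o ∉ Y ∪ T ∧ projLE o Y T ∧ projLE o T Y

/-- A Segre point of `Y`: the projection from `o` is non-birational on `Y`
(it is not generically injective). -/
def SegrePt (Y : Set (PS k n)) (o : PS k n) : Prop :=
  o ∉ Y ∧ ¬ GenericIn Y (fun y => ∀ y' ∈ Y, y'.submodule ≤ o.submodule ⊔ y.submodule → y' = y)

/-- The Segre locus of `Y`. -/
def segreLocus (Y : Set (PS k n)) : Set (PS k n) := closure {o | SegrePt Y o}

/-- `X` is a cone with vertex `v`. -/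
def IsCone (X : Set (PS k n)) (v : PS k n) : Prop :=
  ∀ p ∈ X, ∀ q : PS k n, q.submodule ≤ v.submodule ⊔ p.submodule → q ∈ X

/-- The homogeneous polynomials vanishing on `X`. -/
def homogCut (X : Set (PS k n)) : Set (MvPolynomial (Fin n) k) :=
  {f | (∃ d, f.IsHomogeneous d) ∧ X ⊆ V0 f}

/-- The span of the gradients at `p` of homogeneous polynomials vanishing on `X`. -/
def gradSpan (X : Set (PS k n)) (p : PS k n) : Submodule k (Fin n → k) :=
  Submodule.span k ((fun f => fun i => eval p.rep (pderiv i f)) '' homogCut X)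

/-- Smoothness at a point of an `m`-dimensional subvariety (Jacobian criterion). -/
def IsSmoothPt (X : Set (PS k n)) (m : ℕ) (p : PS k n) : Prop :=
  Module.finrank k ↥(gradSpan X p) = n - (m + 1)

/-- `X` (of dimension `m`) has only isolated singularities. -/
def IsolatedSings (X : Set (PS k n)) (m : ℕ) : Prop :=
  {p ∈ X | ¬ IsSmoothPt X m p}.Finite

/-- `X` (of dimension `m`) is smooth. -/
def IsSmoothVar (X : Set (PS k n)) (m : ℕ) : Prop := ∀ p ∈ X, IsSmoothPt X m p

/-- The hyperplane (as a submodule) determined by a point of the dual projective space. -/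
def hypSub (a : PS k n) : Submodule k (Fin n → k) :=
  LinearMap.ker (∑ i, a.rep i • (LinearMap.proj i : (Fin n → k) →ₗ[k] k))

/-- The hyperplane determined by a point of the dual projective space. -/
def hypOf (a : PS k n) : Set (PS k n) := linSet (hypSub a)

/-- The (geometric) genus of a space curve `C`, defined by the node count of a
projection from a general point of its span: a general point of `⟨C⟩` lies on
`(d-1)(d-2)/2 - g` secant lines of `C`. -/
def HasGenus (C : Set (PS k n)) (g : ℕ) : Prop :=
  ∃ d : ℕ, HasDegree C 1 d ∧
    GenericIn (linSet (pspan C)) (fun q =>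
      2 * (decomps C q).ncard + 2 * g + 3 * d = d * d + 2)

/-- The embedded tangent space of `X` at `p` (as a submodule of the cone). -/
def tangentSub (X : Set (PS k n)) (p : PS k n) : Submodule k (Fin n → k) :=
  ⨅ f ∈ homogCut X,
    LinearMap.ker (∑ i, (eval p.rep (pderiv i f)) • (LinearMap.proj i : (Fin n → k) →ₗ[k] k))

/-- A curve is tangentially degenerate if its general tangent line meets the
curve elsewhere. -/
def TangDeg (X : Set (PS k n)) : Prop :=
  GenericIn {p ∈ X | IsSmoothPt X 1 p}
    (fun p => ∃ y ∈ X, y ≠ p ∧ y.submodule ≤ tangentSub X p)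

/-- The homogeneous ideal of `X`. -/
def projIdeal (X : Set (PS k n)) : Ideal (MvPolynomial (Fin n) k) :=
  Ideal.span {f | X ⊆ V0 f}

/-- `X` is a normal variety: its homogeneous coordinate ring is integrally closed
in its total fraction ring. -/
def IsNormalVar (X : Set (PS k n)) : Prop :=
  ∀ x : FractionRing (MvPolynomial (Fin n) k ⧸ projIdeal X),
    IsIntegral (MvPolynomial (Fin n) k ⧸ projIdeal X) x →
      ∃ y : MvPolynomial (Fin n) k ⧸ projIdeal X,
        algebraMap (MvPolynomial (Fin n) k ⧸ projIdeal X)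
          (FractionRing (MvPolynomial (Fin n) k ⧸ projIdeal X)) y = x

/-- `C` is an irreducible component of `Y`. -/
def IsCompOf (C Y : Set (PS k n)) : Prop :=
  Maximal (fun Z => Z ⊆ Y ∧ IsIrreducible Z) C

/-- The image of `X` under the linear projection from (the linear space of) `W`,
realized inside the complementary linear space of `Λ`. -/
def projFrom (W Λ : Submodule k (Fin n → k)) (X : Set (PS k n)) : Set (PS k n) :=
  {y | y.submodule ≤ Λ ∧ ∃ x ∈ X, y.submodule ≤ W ⊔ x.submodule}

/-- Decompositions of `q` as irredundant spans of one point from each `Xs i`. -/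
def tupleDecomps {s : ℕ} (Xs : Fin s → Set (PS k n)) (q : PS k n) :
    Set (Fin s → PS k n) :=
  {p | (∀ i, p i ∈ Xs i) ∧ Function.Injective p ∧ memSpan q (Set.range p) ∧
    ∀ i, ¬ memSpan q (Set.range p \ {p i})}

/-- The entry locus of `q` with respect to the tuple of varieties `Xs`. -/
def entryLocusT {s : ℕ} (Xs : Fin s → Set (PS k n)) (q : PS k n) : Set (PS k n) :=
  closure (⋃ p ∈ tupleDecomps Xs q, Set.range p)

/-- The join of the varieties `Xs`. -/
def joinT {s : ℕ} (Xs : Fin s → Set (PS k n)) : Set (PS k n) :=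
  closure {q | ∃ p : Fin s → PS k n, (∀ i, p i ∈ Xs i) ∧ memSpan q (Set.range p)}

/-- Relation `q = F(p)` for a tuple `F` of homogeneous polynomials of the same degree. -/
def polyMapRel {N M : ℕ} (F : Fin M → MvPolynomial (Fin N) k) (p : PS k N) (q : PS k M) :
    Prop :=
  q.submodule = Submodule.span k {fun j => eval p.rep (F j)}

/-- `A` and `B` are isomorphic via mutually inverse polynomial maps. -/
def IsPolyIso {N M : ℕ} (A : Set (PS k N)) (B : Set (PS k M)) : Prop :=
  ∃ (d e : ℕ) (F : Fin M → MvPolynomial (Fin N) k) (G : Fin N → MvPolynomial (Fin M) k),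
    (∀ j, (F j).IsHomogeneous d) ∧ (∀ i, (G i).IsHomogeneous e) ∧
    (∀ p ∈ A, ∃ q ∈ B, polyMapRel F p q ∧ polyMapRel G q p) ∧
    (∀ q ∈ B, ∃ p ∈ A, polyMapRel F p q ∧ polyMapRel G q p)

/-- `A` and `B` are birational: polynomially isomorphic on dense open subsets. -/
def Birational (A B : Set (PS k n)) : Prop :=
  ∃ U V : Set (PS k n), IsOpen U ∧ IsOpen V ∧
    A ⊆ closure (A ∩ U) ∧ B ⊆ closure (B ∩ V) ∧ IsPolyIso (A ∩ U) (B ∩ V)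

/-- A finite set `S` imposes independent conditions on hypersurfaces of degree `i`. -/
def ImposesIndep (S : Finset (PS k n)) (i : ℕ) : Prop :=
  Function.Surjective (fun f : ↥(homogeneousSubmodule (Fin n) k i) =>
    fun p : ↥(↑S : Set (PS k n)) => eval (↑p : PS k n).rep (↑f : MvPolynomial (Fin n) k))

end EL

namespace EL

theorem exists_derivation_extension_of_formallyEtale {R A B : Type*} [CommRing R] [CommRing A]
    [CommRing B] [Algebra R A] [Algebra R B] [Algebra A B] [IsScalarTower R A B]
    [Algebra.FormallyEtale A B] (D : Derivation R A B) :
    ∃ E : Derivation R B B, ∀ a, E (algebraMap A B a) = D a := by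
  let l := (TensorProduct.AlgebraTensorModule.lift
    ((LinearMap.ringLmapEquivSelf B B _).symm D.liftKaehlerDifferential) :
      TensorProduct A B (Ω[A⁄R]) →ₗ[B] B)
  refine ⟨(l ∘ₗ
    (KaehlerDifferential.tensorKaehlerEquivOfFormallyEtale R A B).symm.toLinearMap).compDer
    (KaehlerDifferential.D R B), fun a => ?_⟩
  simp [KaehlerDifferential.tensorKaehlerEquivOfFormallyEtale_symm_D_algebraMap, l]

theorem formallyEtale_of_isAlgebraic {A F : Type*} [CommRing A] [IsDomain A] [Field F]
    [Algebra A F] [FaithfulSMul A F] [Algebra.IsAlgebraic A F] [CharZero F] :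
    Algebra.FormallyEtale A F := by
  let := FractionRing.liftAlgebra A F
  have : Algebra.IsAlgebraic (FractionRing A) F :=
    Algebra.IsAlgebraic.extendScalars (R := A) (FaithfulSMul.algebraMap_injective _ _)
  have : CharZero (FractionRing A) :=
    (RingHom.charZero_iff (algebraMap (FractionRing A) F).injective).2 inferInstance
  have : Algebra.FormallyEtale (FractionRing A) F := .of_isSeparable _ _
  have : Algebra.FormallyEtale A (FractionRing A) := .of_isLocalization (nonZeroDivisors A)
  exact .comp A (FractionRing A) F

theorem exists_derivation_extension {k A F : Type*} [CommRing k] [CommRing A] [IsDomain A]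
    [Field F] [Algebra k A] [Algebra k F] [Algebra A F] [IsScalarTower k A F] [FaithfulSMul A F]
    [Algebra.IsAlgebraic A F] [CharZero F] (D : Derivation k A F) :
    ∃ E : Derivation k F F, ∀ a, E (algebraMap A F a) = D a :=
  have := formallyEtale_of_isAlgebraic (A := A) (F := F)
  exists_derivation_extension_of_formallyEtale D

theorem exists_derivation_ne_zero {k F : Type*} [Field k] [Field F] [Algebra k F] [CharZero F]
    {x : F} (hx : Transcendental k x) : ∃ D : Derivation k F F, D x ≠ 0 := by
  classical
  have hs : AlgebraicIndepOn k id ({x} : Set F) := by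
    have := algebraicIndependent_unique_type_iff (R := k) (x := fun i : ({x} : Set F) => (i : F))
    exact this.2 (by simpa using hx)
  obtain ⟨s, hxs, hb⟩ := exists_isTranscendenceBasis_superset hs
  let := (aeval (R := k) (fun i : s => (i : F))).toAlgebra
  have : IsScalarTower k (MvPolynomial s k) F := .of_algHom (aeval (R := k) (fun i : s => (i : F)))
  have : FaithfulSMul (MvPolynomial s k) F :=
    (faithfulSMul_iff_algebraMap_injective _ _).2 hb.1
  have : Algebra.IsAlgebraic (MvPolynomial s k) F := by
    have := hb.isAlgebraic
    refine .of_ringHom_of_comp_eq hb.1.aevalEquiv (RingHom.id F) (AlgEquiv.surjective _)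
      Function.injective_id (RingHom.ext fun p => ?_)
    exact hb.1.algebraMap_aevalEquiv p
  let i : s := ⟨x, hxs rfl⟩
  obtain ⟨E, hE⟩ := exists_derivation_extension (k := k) (A := MvPolynomial s k) (F := F)
    (mkDerivation k (Pi.single i 1))
  refine ⟨E, ?_⟩
  have h := hE (X i)
  have h2 : algebraMap (MvPolynomial s k) F (X i) = x := by
    change aeval _ (X i) = x
    simp [i]
  rw [h2] at h
  simp [h, mkDerivation_X]

theorem derivation_eq_zero_of_isAlgebraic {k F : Type*} [Field k] [Field F] [Algebra k F]
    [CharZero F] (D : Derivation k F F) {x : F} (hx : IsAlgebraic k x) : D x = 0 := by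
  have : CharZero k := (RingHom.charZero_iff (algebraMap k F).injective).2 inferInstance
  have hi := hx.isIntegral
  have h := Derivation.map_aeval D (minpoly k x) x
  rw [minpoly.aeval, map_zero] at h
  have := (minpoly.irreducible hi).separable.aeval_derivative_ne_zero (minpoly.aeval k x)
  simpa [this] using h.symm

theorem exists_algebraMap_eq_of_isAlgebraic {k A : Type*} [Field k] [IsAlgClosed k] [CommRing A]
    [IsDomain A] [Algebra k A] {x : A} (hx : IsAlgebraic k x) : ∃ c, algebraMap k A c = x :=
  minpoly.mem_range_of_degree_eq_one k x
    (IsAlgClosed.degree_eq_one_of_irreducible k (minpoly.irreducible hx.isIntegral))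

theorem exists_derivation_of_transcendental {k σ : Type*} [Field k] [CharZero k] [Finite σ]
    (I : Ideal (MvPolynomial σ k)) [I.IsPrime] {i : σ}
    (hi : Transcendental k (Ideal.Quotient.mk I (X i))) :
    ∃ D : Derivation k (MvPolynomial σ k) (MvPolynomial σ k), (∀ f ∈ I, D f ∈ I) ∧ D (X i) ∉ I := by
  let R := MvPolynomial σ k ⧸ I
  let F := FractionRing R
  let φ : MvPolynomial σ k →ₐ[k] F :=
    (IsScalarTower.toAlgHom k R F).comp (Ideal.Quotient.mkₐ k I)
  have hφ : ∀ f, φ f = 0 ↔ f ∈ I := fun f => by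
    rw [← Ideal.Quotient.eq_zero_iff_mem, ← map_eq_zero_iff (algebraMap R F)
      (IsFractionRing.injective R F)]
    rfl
  have : CharZero F := (RingHom.charZero_iff (algebraMap k F).injective).1 inferInstance
  have hx : Transcendental k (φ (X i)) :=
    (transcendental_algebraMap_iff (IsFractionRing.injective R F)).2 hi
  obtain ⟨E, hE⟩ := exists_derivation_ne_zero hx
  obtain ⟨b, hb⟩ := IsLocalization.exist_integer_multiples_of_finite (nonZeroDivisors R)
    fun j => E (φ (X j))
  choose r hr using hb
  choose g hg using fun j => Ideal.Quotient.mk_surjective (r j)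
  have key : ∀ f, φ (mkDerivation k g f) = algebraMap R F b * E (φ f) := fun f => by
    induction f using MvPolynomial.induction_on with
    | C a => simp [← algebraMap_eq]
    | add p q hp hq => simp [hp, hq, mul_add]
    | mul_X p j hp =>
      have hj : φ (g j) = algebraMap R F b * E (φ (X j)) := by
        change algebraMap R F (Ideal.Quotient.mk I (g j)) = _
        rw [hg, hr, Algebra.smul_def]
      simp only [Derivation.leibniz, mkDerivation_X, smul_eq_mul, map_add, map_mul, hp, hj]
      ring
  refine ⟨mkDerivation k g, fun f hf => ?_, fun h => ?_⟩
  · rw [← hφ, key, (hφ f).2 hf, map_zero, mul_zero]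
  · rw [← hφ, key, mul_eq_zero, map_eq_zero_iff _ (IsFractionRing.injective R F)] at h
    exact h.elim (nonZeroDivisors.ne_zero b.2) hE

theorem exists_derivation_of_apply_ne {k σ : Type*} [Field k] [IsAlgClosed k] [CharZero k]
    [Finite σ] {V : Set (σ → k)} (hV : (vanishingIdeal k V).IsPrime) {v w : σ → k} (hv : v ∈ V)
    (hw : w ∈ V) {i : σ} (hvw : v i ≠ w i) :
    ∃ D : Derivation k (MvPolynomial σ k) (MvPolynomial σ k),
      (∀ f ∈ vanishingIdeal k V, D f ∈ vanishingIdeal k V) ∧ D (X i) ∉ vanishingIdeal k V := by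
  refine exists_derivation_of_transcendental _ fun hi => hvw ?_
  obtain ⟨c, hc⟩ := exists_algebraMap_eq_of_isAlgebraic hi
  have h : (C c - X i : MvPolynomial σ k) ∈ vanishingIdeal k V := by
    rw [← Ideal.Quotient.eq_zero_iff_mem, map_sub, ← hc, sub_eq_zero]
    rfl
  have h1 := h v hv
  have h2 := h w hw
  simp only [map_sub, aeval_X, aeval_C, sub_eq_zero] at h1 h2
  exact h1.symm.trans h2

theorem exists_common_root {R k L : Type*} [CommRing R] [IsDomain R] [Field k] [Field L]
    [IsAlgClosed L] [Algebra R L] [FaithfulSMul R L] (s : Set (Polynomial R))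
    (hs : ∀ h : R, h ≠ 0 → ∃ (e : R →+* k) (c : k), e h ≠ 0 ∧ ∀ p ∈ s, p.eval₂ e c = 0) :
    ∃ c : L, ∀ p ∈ s, Polynomial.aeval c p = 0 := by
  let F := FractionRing R
  let _ := FractionRing.liftAlgebra R L
  let _ := Polynomial.algebra R F
  have := Polynomial.isLocalization (nonZeroDivisors R) F
  let J := (Ideal.span s).map (algebraMap (Polynomial R) (Polynomial F))
  have hJ : J ≠ ⊤ := by
    rw [IsLocalization.map_algebraMap_ne_top_iff_disjoint
      ((nonZeroDivisors R).map (Polynomial.C : R →+* Polynomial R)), Set.disjoint_left]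
    rintro _ ⟨h, hh, rfl⟩ hm
    obtain ⟨e, c, heh, hc⟩ := hs h (nonZeroDivisors.ne_zero hh)
    have : Ideal.span s ≤ RingHom.ker (Polynomial.eval₂RingHom e c) :=
      Ideal.span_le.2 fun p hp => by simpa using hc p hp
    have := this hm
    simp [heh] at this
  obtain ⟨g, hg⟩ := (IsPrincipalIdealRing.principal J).principal
  have hg' : g = 0 ∨ g.degree ≠ 0 := by
    by_contra! h
    refine hJ (hg.trans ?_)
    exact Ideal.span_singleton_eq_top.2 (Polynomial.isUnit_iff_degree_eq_zero.2 h.2)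
  obtain ⟨c, hc⟩ : ∃ c : L, Polynomial.aeval c g = 0 := by
    rcases hg' with rfl | h
    · exact ⟨0, by simp⟩
    · exact IsAlgClosed.exists_aeval_eq_zero L g h
  refine ⟨c, fun p hp => ?_⟩
  have hpJ : algebraMap (Polynomial R) (Polynomial F) p ∈ J :=
    Ideal.mem_map_of_mem _ (Ideal.subset_span hp)
  rw [hg, Submodule.mem_span_singleton] at hpJ
  obtain ⟨q, hq⟩ := hpJ
  have := congr_arg (Polynomial.aeval c) hq
  rw [smul_eq_mul, map_mul, hc, mul_zero] at this
  have h2 : algebraMap (Polynomial R) (Polynomial F) p = p.map (algebraMap R F) := rfl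
  rw [h2, Polynomial.aeval_map_algebraMap] at this
  exact this.symm

theorem exists_genericPoint {k σ : Type} [Field k] [CharZero k] (I : Ideal (MvPolynomial σ k))
    [I.IsPrime] :
    ∃ (L : Type) (_ : Field L) (_ : Algebra k L) (x : σ → L),
      (∀ f, aeval x f = 0 ↔ f ∈ I) ∧
      (∀ D : Derivation k (MvPolynomial σ k) (MvPolynomial σ k), (∀ f ∈ I, D f ∈ I) →
        ∃ δ : Derivation k L L, ∀ f, δ (aeval x f) = aeval x (D f)) ∧
      ∀ s : Set (Polynomial (MvPolynomial σ k)),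
        (∀ h ∉ I, ∃ (v : σ → k) (c : k), v ∈ zeroLocus k I ∧ eval v h ≠ 0 ∧
          ∀ p ∈ s, p.eval₂ (eval v) c = 0) →
        ∃ c : L, ∀ p ∈ s, p.eval₂ (aeval x : MvPolynomial σ k →ₐ[k] L).toRingHom c = 0 := by
  let R := MvPolynomial σ k ⧸ I
  let F := FractionRing R
  let L := AlgebraicClosure F
  let π : MvPolynomial σ k →ₐ[k] R := Ideal.Quotient.mkₐ k I
  have hπ : Function.Surjective π := Ideal.Quotient.mk_surjective
  have hπ0 : ∀ f, π f = 0 ↔ f ∈ I := fun f => Ideal.Quotient.eq_zero_iff_mem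
  have : Algebra.IsAlgebraic R F := IsLocalization.isAlgebraic F (nonZeroDivisors R)
  have : Algebra.IsAlgebraic R L := .trans R F L
  have hinj : Function.Injective (algebraMap R L) := by
    rw [IsScalarTower.algebraMap_eq R F L]
    exact (algebraMap F L).injective.comp (IsFractionRing.injective R F)
  have : FaithfulSMul R L := (faithfulSMul_iff_algebraMap_injective _ _).2 hinj
  have : CharZero L := (RingHom.charZero_iff (algebraMap k L).injective).1 inferInstance
  have hx : ∀ f, aeval (fun i => algebraMap R L (π (X i))) f = algebraMap R L (π f) := fun f => by
    have : aeval (fun i => algebraMap R L (π (X i))) = (IsScalarTower.toAlgHom k R L).comp π := by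
      ext; simp
    rw [this]
    rfl
  refine ⟨L, inferInstance, inferInstance, fun i => algebraMap R L (π (X i)), fun f => ?_,
    fun D hD => ?_, fun s hs => ?_⟩
  · rw [hx, map_eq_zero_iff _ hinj, hπ0]
  · obtain ⟨δ, hδ⟩ := exists_derivation_extension (A := R) (F := L)
      ((Algebra.linearMap R L).compDer
        (Derivation.liftOfSurjective (d := D) hπ fun f hf => (hπ0 _).2 (hD f ((hπ0 f).1 hf))))
    refine ⟨δ, fun f => ?_⟩
    rw [hx, hx, hδ]
    exact congr_arg (algebraMap R L) (Derivation.liftOfSurjective_apply hπ _ f)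
  · obtain ⟨c, hc⟩ := exists_common_root (L := L) (k := k)
      (Polynomial.map (π : MvPolynomial σ k →+* R) '' s) fun h hh => by
      obtain ⟨h, rfl⟩ := hπ h
      obtain ⟨v, c, hv, hvh, hc⟩ := hs h (fun hI => hh ((hπ0 h).2 hI))
      refine ⟨Ideal.Quotient.lift I (eval v) hv, c, hvh, ?_⟩
      rintro _ ⟨p, hp, rfl⟩
      rw [Polynomial.eval₂_map]
      exact hc p hp
    refine ⟨c, fun p hp => ?_⟩
    have h := hc _ ⟨p, hp, rfl⟩
    rw [Polynomial.aeval_def, Polynomial.eval₂_map] at h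
    convert h using 2
    ext <;> simp [hx]

theorem algHom_derivation_comm {k σ A : Type*} [CommRing k] [CommRing A] [Algebra k A]
    (ρ : MvPolynomial σ k →ₐ[k] A) (Δ : Derivation k (MvPolynomial σ k) (MvPolynomial σ k))
    (D : Derivation k A A) (h : ∀ i, ρ (Δ (X i)) = D (ρ (X i))) (f : MvPolynomial σ k) :
    ρ (Δ f) = D (ρ f) := by
  induction f using MvPolynomial.induction_on with
  | C a => simp [← algebraMap_eq]
  | add p q hp hq => simp [hp, hq]
  | mul_X p j hp => simp [Derivation.leibniz, hp, h]

theorem aeval_aeval_sumElim_algebraMap {k A σ τ : Type*} [Field k] [CommRing A] [Algebra k A]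
    (v : σ → k) (w : τ → A) (f : MvPolynomial (σ ⊕ τ) k) :
    aeval w (aeval (Sum.elim (fun i => C (v i)) X : σ ⊕ τ → MvPolynomial τ k) f) =
      aeval (Sum.elim (fun i => algebraMap k A (v i)) w) f := by
  rw [← AlgHom.comp_apply]
  congr 1
  ext i
  rcases i with i | i <;> simp

theorem aeval_aeval_sumElim_left {k σ τ : Type*} [Field k] (v : σ → k) (w : τ → k)
    (f : MvPolynomial (σ ⊕ τ) k) :
    aeval w (aeval (Sum.elim (fun i => C (v i)) X) f) = aeval (Sum.elim v w) f :=
  aeval_aeval_sumElim_algebraMap v w f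

theorem aeval_aeval_sumElim_right {k σ τ : Type*} [Field k] (v : σ → k) (w : τ → k)
    (f : MvPolynomial (σ ⊕ τ) k) :
    aeval v (aeval (Sum.elim X fun i => C (w i)) f) = aeval (Sum.elim v w) f := by
  rw [← AlgHom.comp_apply]
  congr 1
  ext i
  rcases i with i | i <;> simp

theorem exists_aeval_ne_zero_and {k σ : Type*} [Field k] {V : Set (σ → k)}
    (hV : (vanishingIdeal k V).IsPrime) {f g : MvPolynomial σ k} (hf : ∃ v ∈ V, aeval v f ≠ 0)
    (hg : ∃ v ∈ V, aeval v g ≠ 0) : ∃ v ∈ V, aeval v f ≠ 0 ∧ aeval v g ≠ 0 := by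
  by_contra! h
  have := hV.mem_or_mem (x := f) (y := g) fun v hv => by
    by_cases hfv : aeval v f = 0
    · rw [map_mul, hfv, zero_mul]
    · rw [map_mul, h v hv hfv, mul_zero]
  simp only [mem_vanishingIdeal_iff] at this
  grind

theorem nonempty_of_isPrime_vanishingIdeal {k σ : Type*} [Field k] {V : Set (σ → k)}
    (hV : (vanishingIdeal k V).IsPrime) : V.Nonempty :=
  Set.nonempty_iff_ne_empty.2 fun h => hV.ne_top (h ▸ vanishingIdeal_empty)

theorem isPrime_vanishingIdeal_sumElim {k σ τ : Type*} [Field k] {V : Set (σ → k)}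
    {W : Set (τ → k)} (hV : (vanishingIdeal k V).IsPrime) (hW : (vanishingIdeal k W).IsPrime) :
    (vanishingIdeal k (Set.image2 Sum.elim V W)).IsPrime := by
  refine ⟨fun h => ?_, fun {f g} hfg => ?_⟩
  · obtain ⟨v, hv⟩ := nonempty_of_isPrime_vanishingIdeal hV
    obtain ⟨w, hw⟩ := nonempty_of_isPrime_vanishingIdeal hW
    have := (Ideal.eq_top_iff_one _).1 h _ (Set.mem_image2_of_mem hv hw)
    simp at this
  · by_contra! h
    simp only [mem_vanishingIdeal_iff, Set.forall_mem_image2, not_forall] at h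
    obtain ⟨⟨v₁, hv₁, w₁, hw₁, hf⟩, v₂, hv₂, w₂, hw₂, hg⟩ := h
    rw [← aeval_aeval_sumElim_right] at hf hg
    obtain ⟨v, hv, hf, hg⟩ := exists_aeval_ne_zero_and hV ⟨v₁, hv₁, hf⟩ ⟨v₂, hv₂, hg⟩
    rw [aeval_aeval_sumElim_right, ← aeval_aeval_sumElim_left] at hf hg
    obtain ⟨w, hw, hf, hg⟩ := exists_aeval_ne_zero_and hW ⟨w₁, hw₁, hf⟩ ⟨w₂, hw₂, hg⟩
    rw [aeval_aeval_sumElim_left] at hf hg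
    have := hfg _ (Set.mem_image2_of_mem hv hw)
    rw [map_mul] at this
    exact mul_ne_zero hf hg this

theorem exists_genericPoint_prod {k σ τ : Type} [Field k] [CharZero k] {V : Set (σ → k)}
    {W : Set (τ → k)} (hV : (vanishingIdeal k V).IsPrime) (hW : (vanishingIdeal k W).IsPrime)
    (D₁ : Derivation k (MvPolynomial σ k) (MvPolynomial σ k))
    (hD₁ : ∀ f ∈ vanishingIdeal k V, D₁ f ∈ vanishingIdeal k V)
    (D₂ : Derivation k (MvPolynomial τ k) (MvPolynomial τ k))
    (hD₂ : ∀ f ∈ vanishingIdeal k W, D₂ f ∈ vanishingIdeal k W) :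
    ∃ (L : Type) (_ : Field L) (_ : Algebra k L) (u : σ → L) (v : τ → L)
      (δ₁ δ₂ : Derivation k L L),
      (∀ f : MvPolynomial (σ ⊕ τ) k, aeval (Sum.elim u v) f = 0 ↔
        ∀ o ∈ V, ∀ y ∈ W, aeval (Sum.elim o y) f = 0) ∧
      (∀ i, δ₁ (u i) = aeval u (D₁ (X i))) ∧ (∀ i, δ₁ (v i) = 0) ∧
      (∀ i, δ₂ (u i) = 0) ∧ (∀ i, δ₂ (v i) = aeval v (D₂ (X i))) ∧
      ∀ s : Set (Polynomial (MvPolynomial (σ ⊕ τ) k)),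
        (∀ o ∈ V, ∀ y ∈ W, ∃ c : k, ∀ p ∈ s, p.eval₂ (eval (Sum.elim o y)) c = 0) →
        ∃ c : L, ∀ p ∈ s,
          p.eval₂ (aeval (Sum.elim u v) : MvPolynomial (σ ⊕ τ) k →ₐ[k] L).toRingHom c = 0 := by
  have hP := isPrime_vanishingIdeal_sumElim hV hW
  obtain ⟨L, _, _, x, hx, hδ, hs⟩ :=
    exists_genericPoint (vanishingIdeal k (Set.image2 Sum.elim V W))
  obtain ⟨δ₁, h₁⟩ := hδ (mkDerivation k (Sum.elim (fun i => rename Sum.inl (D₁ (X i))) 0)) <| by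
    rintro f hf _ ⟨v, hv, w, hw, rfl⟩
    rw [← aeval_aeval_sumElim_right, algHom_derivation_comm _ _ D₁]
    · exact hD₁ _ (fun v hv => by
        rw [aeval_aeval_sumElim_right]; exact hf _ (Set.mem_image2_of_mem hv hw)) _ hv
    · rintro (i | i)
      · simp [mkDerivation_X, bind₁_rename, bind₁_X_left]
      · simp [mkDerivation_X, ← algebraMap_eq]
  obtain ⟨δ₂, h₂⟩ := hδ (mkDerivation k (Sum.elim 0 (fun i => rename Sum.inr (D₂ (X i))))) <| by
    rintro f hf _ ⟨v, hv, w, hw, rfl⟩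
    rw [← aeval_aeval_sumElim_left, algHom_derivation_comm _ _ D₂]
    · exact hD₂ _ (fun w hw => by
        rw [aeval_aeval_sumElim_left]; exact hf _ (Set.mem_image2_of_mem hv hw)) _ hw
    · rintro (i | i)
      · simp [mkDerivation_X, ← algebraMap_eq]
      · simp [mkDerivation_X, bind₁_rename, bind₁_X_left]
  have hxe : Sum.elim (x ∘ Sum.inl) (x ∘ Sum.inr) = x := Sum.elim_comp_inl_inr x
  refine ⟨L, _, _, x ∘ Sum.inl, x ∘ Sum.inr, δ₁, δ₂, fun f => ?_, fun i => ?_, fun i => ?_,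
    fun i => ?_, fun i => ?_, fun s h => ?_⟩
  · rw [hxe, hx, mem_vanishingIdeal_iff, Set.forall_mem_image2]
  · simpa [mkDerivation_X, aeval_rename] using h₁ (X (Sum.inl i))
  · simpa [mkDerivation_X] using h₁ (X (Sum.inr i))
  · simpa [mkDerivation_X] using h₂ (X (Sum.inl i))
  · simpa [mkDerivation_X, aeval_rename] using h₂ (X (Sum.inr i))
  · rw [hxe]
    refine hs s fun g hg => ?_
    simp only [mem_vanishingIdeal_iff, Set.forall_mem_image2, not_forall] at hg
    obtain ⟨o, ho, y, hy, hg⟩ := hg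
    obtain ⟨c, hc⟩ := h o ho y hy
    exact ⟨_, c, zeroLocus_vanishingIdeal_le _ (Set.mem_image2_of_mem ho hy), hg, hc⟩

theorem exists_isAlgebraic_adjoin_or_exists_isPrime_chain {k : Type*} [Field k] {n : ℕ}
    (Q : Ideal (MvPolynomial (Fin n) k)) [Q.IsPrime] :
    (∃ z : MvPolynomial (Fin n) k ⧸ Q, ∀ x : MvPolynomial (Fin n) k ⧸ Q,
      IsAlgebraic (Algebra.adjoin k {z}) x) ∨
    ∃ Q₀ Q₁ Q₂ : Ideal (MvPolynomial (Fin n) k), Q₀.IsPrime ∧ Q₁.IsPrime ∧ Q₂.IsPrime ∧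
      Q ≤ Q₀ ∧ Q₀ < Q₁ ∧ Q₁ < Q₂ := by
  obtain ⟨s, -, g, hg, hgi⟩ := exists_integral_inj_algHom_of_quotient Q Ideal.IsPrime.ne_top'
  let R := MvPolynomial (Fin n) k ⧸ Q
  rcases le_or_gt 2 s with hs | hs
  · right
    obtain ⟨l, hl⟩ : ∃ l : LTSeries (PrimeSpectrum (MvPolynomial (Fin s) k)), l.length = s := by
      rw [← Order.le_krullDim_iff]
      exact (by simp [MvPolynomial.ringKrullDim_of_isNoetherianRing] :
        (s : WithBot ℕ∞) ≤ ringKrullDim (MvPolynomial (Fin s) k))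
    let p : ℕ → Ideal (MvPolynomial (Fin s) k) := fun i => (l (Fin.ofNat _ i)).asIdeal
    have hp : ∀ i, (p i).IsPrime := fun i => (l _).isPrime
    have hlt : ∀ i < s, p i < p (i + 1) := fun i hi =>
      l.strictMono <| by
        rw [Fin.lt_def]
        simp [Nat.mod_eq_of_lt (show i < l.length + 1 by omega),
          Nat.mod_eq_of_lt (show i + 1 < l.length + 1 by omega)]
    let _ := g.toRingHom.toAlgebra
    have : Algebra.IsIntegral (MvPolynomial (Fin s) k) R := ⟨hgi⟩
    have up := fun (P : Ideal (MvPolynomial (Fin s) k)) (_ : P.IsPrime) (I : Ideal R)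
      (hI : I.comap (algebraMap _ R) ≤ P) =>
        Ideal.exists_ideal_over_prime_of_isIntegral (R := MvPolynomial (Fin s) k) (S := R) P I hI
    obtain ⟨q₀, -, h₀, h₀'⟩ := up (p 0) (hp _) ⊥ <|
      ((RingHom.injective_iff_ker_eq_bot g.toRingHom).1 hg).trans_le bot_le
    obtain ⟨q₁, h₀₁, h₁, h₁'⟩ := up (p 1) (hp _) q₀ (h₀' ▸ (hlt 0 (by omega)).le)
    obtain ⟨q₂, h₁₂, h₂, h₂'⟩ := up (p 2) (hp _) q₁ (h₁' ▸ (hlt 1 (by omega)).le)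
    have hmono := Ideal.comap_injective_of_surjective (Ideal.Quotient.mk Q)
      Ideal.Quotient.mk_surjective
    refine ⟨q₀.comap (Ideal.Quotient.mk Q), q₁.comap (Ideal.Quotient.mk Q),
      q₂.comap (Ideal.Quotient.mk Q), h₀.comap _, h₁.comap _, h₂.comap _, ?_,
      lt_of_le_of_ne (Ideal.comap_mono h₀₁) fun h => ?_,
      lt_of_le_of_ne (Ideal.comap_mono h₁₂) fun h => ?_⟩
    · exact Ideal.mk_ker.symm.le.trans (Ideal.ker_le_comap _)
    · exact (hlt 0 (by omega)).ne (h₀'.symm.trans ((congr_arg _ (hmono h)).trans h₁'))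
    · exact (hlt 1 (by omega)).ne (h₁'.symm.trans ((congr_arg _ (hmono h)).trans h₂'))
  · left
    have hss : Subsingleton (Fin s) := Fin.subsingleton_iff_le_one.2 (by omega)
    obtain ⟨z, hz⟩ : ∃ z : R, ∀ i, g (X i) = z := by
      rcases isEmpty_or_nonempty (Fin s) with h | ⟨⟨i⟩⟩
      · exact ⟨0, fun i => isEmptyElim i⟩
      · exact ⟨g (X i), fun j => by rw [Subsingleton.elim i j]⟩
    refine ⟨z, fun x => IsIntegral.isAlgebraic ?_⟩
    have hgz : ∀ f, g f ∈ Algebra.adjoin k {z} := fun f => by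
      induction f using MvPolynomial.induction_on with
      | C a =>
        rw [← algebraMap_eq, AlgHom.commutes]
        exact Subalgebra.algebraMap_mem _ _
      | add p q hp hq => rw [map_add]; exact add_mem hp hq
      | mul_X p i hp =>
        rw [map_mul, hz]
        exact mul_mem hp (Algebra.self_mem_adjoin_singleton k z)
    obtain ⟨p, hp, hpx⟩ := hgi x
    refine ⟨p.map (g.codRestrict _ hgz).toRingHom, hp.map _, ?_⟩
    rw [Polynomial.eval₂_map]
    exact hpx

theorem Derivation.eq_zero_of_isAlgebraic_adjoin {k L : Type*} [Field k] [Field L] [Algebra k L]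
    [CharZero L] (δ : Derivation k L L) {a x : L} (ha : δ a = 0)
    (hx : IsAlgebraic (Algebra.adjoin k {a}) x) : δ x = 0 := by
  let K := IntermediateField.adjoin k {a}
  have hK : ∀ c ∈ K, δ c = 0 := fun c hc => by
    induction hc using IntermediateField.adjoin_induction with
    | mem y hy => rw [Set.mem_singleton_iff.1 hy, ha]
    | algebraMap y => simp
    | add y z _ _ hy hz => simp [hy, hz]
    | inv y _ hy => simp [Derivation.leibniz_inv, hy]
    | mul y z _ _ hy hz => simp [Derivation.leibniz, hy, hz]
  let δ' : Derivation K L L := Derivation.mk'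
    { toFun := δ, map_add' := map_add δ
      map_smul' := fun c y => by
        simp [Algebra.smul_def, Derivation.leibniz, hK c c.2, IntermediateField.algebraMap_apply] }
    fun y z => δ.leibniz y z
  refine derivation_eq_zero_of_isAlgebraic δ' ?_
  obtain ⟨p, hp, hpx⟩ := hx
  let ι : Algebra.adjoin k {a} →+* K :=
    (Subalgebra.inclusion (IntermediateField.algebra_adjoin_le_adjoin k {a})).toRingHom
  have hι : Function.Injective ι :=
    Subalgebra.inclusion_injective (IntermediateField.algebra_adjoin_le_adjoin k {a})
  refine ⟨p.map ι, (Polynomial.map_ne_zero_iff hι).2 hp, ?_⟩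
  rw [Polynomial.aeval_def, Polynomial.eval₂_map]
  exact hpx

theorem isAlgebraic_adjoin_of_forall_isAlgebraic {k L ι : Type*} [Field k] [Field L] [Algebra k L]
    {τ : ι → L} {z a : L} (h : ∀ i, IsAlgebraic (Algebra.adjoin k {z}) (τ i))
    (ha : a ∈ IntermediateField.adjoin k (Set.range τ)) (hta : Transcendental k a) (i : ι) :
    IsAlgebraic (Algebra.adjoin k {a}) (τ i) := by
  let M := AlgebraicIndependent.matroid k L
  have mem_iff : ∀ (s : Set L) (x : L), x ∈ M.closure s ↔ IsAlgebraic (Algebra.adjoin k s) x :=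
    fun s x => by
      rw [AlgebraicIndependent.matroid_closure_eq]
      rfl
  have haz : a ∈ M.closure (insert z ∅) := by
    rw [mem_iff, insert_empty_eq]
    clear hta
    induction ha using IntermediateField.adjoin_induction with
    | mem y hy => obtain ⟨i, rfl⟩ := hy; exact h i
    | algebraMap y => exact isAlgebraic_algebraMap (algebraMap k (Algebra.adjoin k {z}) y)
    | add y z _ _ hy hz => exact hy.add hz
    | inv y _ hy => exact hy.inv
    | mul y z _ _ hy hz => exact hy.mul hz
  have ha0 : a ∉ M.closure ∅ := by
    rw [mem_iff, Algebra.adjoin_empty]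
    exact fun h => hta (h.of_ringHom_of_comp_eq (Algebra.botEquiv k L).symm (RingHom.id L)
      (AlgEquiv.surjective _) Function.injective_id rfl)
  have hza := Matroid.mem_closure_insert ha0 haz
  have := h i
  rw [← mem_iff, ← insert_empty_eq] at this ⊢
  exact Matroid.closure_subset_closure_of_subset_closure (Set.insert_subset hza
    (Set.empty_subset _)) this

theorem aeval_smul_of_isHomogeneous {k σ A : Type*} [CommRing k] [CommRing A] [Algebra k A]
    {f : MvPolynomial σ k} {d : ℕ} (hf : f.IsHomogeneous d) (c : A) (v : σ → A) :
    aeval (c • v) f = c ^ d * aeval v f := by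
  simp only [aeval_def, eval₂_eq, Finset.mul_sum]
  refine Finset.sum_congr rfl fun m hm => ?_
  have hd : ∑ i ∈ m.support, m i = d := by
    simpa [Finsupp.weight_apply, Finsupp.sum] using hf (mem_support_iff.1 hm)
  simp only [Pi.smul_apply, smul_eq_mul, mul_pow, Finset.prod_mul_distrib,
    Finset.prod_pow_eq_pow_sum, hd]
  ring

section

variable {k : Type} [Field k] {n : ℕ}

theorem exists_mk_eq (p : PS k n) :
    ∃ (v : Fin n → k) (hv : v ≠ 0), Projectivization.mk k v hv = p :=
  ⟨p.rep, p.rep_nonzero, p.mk_rep⟩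

theorem mk_mem_V0 {f : MvPolynomial (Fin n) k} {d : ℕ} (hf : f.IsHomogeneous d)
    {v : Fin n → k} (hv : v ≠ 0) : Projectivization.mk k v hv ∈ V0 f ↔ eval v f = 0 := by
  refine ⟨fun h => h v hv rfl, fun h w hw hwv => ?_⟩
  obtain ⟨a, rfl⟩ := (Projectivization.mk_eq_mk_iff' k w v hw hv).1 hwv
  have := aeval_smul_of_isHomogeneous hf a v
  rw [aeval_eq_eval, aeval_eq_eval] at this
  rw [this, h, mul_zero]

theorem isClosed_V0 {f : MvPolynomial (Fin n) k} {d : ℕ} (hf : f.IsHomogeneous d) :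
    IsClosed (V0 f) :=
  ⟨TopologicalSpace.isOpen_generateFrom_of_mem ⟨d, f, hf, rfl⟩⟩

theorem exists_homogeneous_of_mem_isOpen {U : Set (PS k n)} (hU : IsOpen U) {p : PS k n}
    (hp : p ∈ U) : ∃ d, ∃ f : MvPolynomial (Fin n) k, f.IsHomogeneous d ∧ p ∉ V0 f ∧
      (V0 f)ᶜ ⊆ U := by
  induction hU with
  | basic s hs =>
    obtain ⟨d, f, hf, rfl⟩ := hs
    exact ⟨d, f, hf, hp, subset_rfl⟩
  | univ =>
    refine ⟨0, 1, isHomogeneous_one _ _, fun h => ?_, Set.subset_univ _⟩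
    simpa using h p.rep p.rep_nonzero p.mk_rep
  | inter s t _ _ ihs iht =>
    obtain ⟨d, f, hf, hpf, hfs⟩ := ihs hp.1
    obtain ⟨e, g, hg, hpg, hgt⟩ := iht hp.2
    refine ⟨d + e, f * g, hf.mul hg, fun h => ?_, fun q hq => ⟨hfs fun h => hq ?_,
      hgt fun h => hq ?_⟩⟩
    · obtain ⟨v, hv, rfl⟩ := exists_mk_eq p
      rw [mk_mem_V0 hf] at hpf
      rw [mk_mem_V0 hg] at hpg
      rw [mk_mem_V0 (hf.mul hg), map_mul] at h
      exact mul_ne_zero hpf hpg h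
    · exact fun v hv hvq => by rw [map_mul, h v hv hvq, zero_mul]
    · exact fun v hv hvq => by rw [map_mul, h v hv hvq, mul_zero]
  | sUnion S _ ih =>
    obtain ⟨s, hs, hps⟩ := hp
    obtain ⟨d, f, hf, hpf, hfs⟩ := ih s hs hps
    exact ⟨d, f, hf, hpf, hfs.trans (Set.subset_sUnion_of_mem hs)⟩

theorem exists_homogCut_of_notMem {X : Set (PS k n)} (hX : IsClosed X) {p : PS k n} (hp : p ∉ X) :
    ∃ f ∈ homogCut X, p ∉ V0 f := by
  obtain ⟨d, f, hf, hpf, hfX⟩ := exists_homogeneous_of_mem_isOpen hX.isOpen_compl hp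
  exact ⟨f, ⟨⟨d, hf⟩, fun q hq => by_contra fun h => hfX h hq⟩, hpf⟩

theorem exists_linear_separating {p q : PS k n} (hpq : p ≠ q) :
    ∃ f : MvPolynomial (Fin n) k, f.IsHomogeneous 1 ∧ p ∈ V0 f ∧ q ∉ V0 f := by
  obtain ⟨v, hv, rfl⟩ := exists_mk_eq p
  obtain ⟨w, hw, rfl⟩ := exists_mk_eq q
  obtain ⟨j, hj⟩ := Function.ne_iff.1 hv
  by_contra! h
  have hf : ∀ i, (C (v j) * X i - C (v i) * X j : MvPolynomial (Fin n) k).IsHomogeneous 1 :=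
    fun i => ((isHomogeneous_X k i).C_mul _).sub ((isHomogeneous_X k j).C_mul _)
  have hw' : ∀ i, v j * w i = v i * w j := fun i => by
    have := h _ (hf i) ((mk_mem_V0 (hf i) hv).2 (by simp [mul_comm]))
    rw [mk_mem_V0 (hf i)] at this
    simpa [sub_eq_zero] using this
  refine hpq (Eq.symm ((Projectivization.mk_eq_mk_iff' k w v hw hv).2 ⟨w j / v j, ?_⟩))
  ext i
  have := hw' i
  rw [Pi.smul_apply, smul_eq_mul, div_mul_eq_mul_div, mul_comm (w j), ← this, mul_div_cancel_left₀]
  exact hj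

theorem exists_homogenization (j : Fin n) (f : MvPolynomial (Fin n) k) :
    ∃ d, ∃ F : MvPolynomial (Fin n) k, F.IsHomogeneous d ∧
      ∀ v : Fin n → k, v j = 1 → eval v F = eval v f := by
  refine ⟨f.totalDegree, ∑ i ∈ Finset.range (f.totalDegree + 1),
    homogeneousComponent i f * X j ^ (f.totalDegree - i), ?_, fun v hv => ?_⟩
  · refine IsHomogeneous.sum _ _ _ fun i hi => ?_
    convert (homogeneousComponent_isHomogeneous i f).mul
      ((isHomogeneous_X k j).pow (f.totalDegree - i)) using 1
    have := Finset.mem_range.1 hi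
    omega
  · conv_rhs => rw [← sum_homogeneousComponent f]
    simp [hv]

/-- The affine part of `S` in the chart where the `j`-th coordinate is `1`. -/
def affinePart (j : Fin n) (S : Set (PS k n)) : Set (Fin n → k) :=
  {v | v j = 1 ∧ ∃ hv : v ≠ 0, Projectivization.mk k v hv ∈ S}

theorem eval_eq_zero_of_mem_affinePart {S : Set (PS k n)} {j : Fin n} {v : Fin n → k}
    (hv : v ∈ affinePart j S) {f : MvPolynomial (Fin n) k} (hf : S ⊆ V0 f) : eval v f = 0 := by
  obtain ⟨-, hv0, hvS⟩ := hv
  exact hf hvS v hv0 rfl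

theorem subset_V0_X_union {S : Set (PS k n)} {j : Fin n} {f : MvPolynomial (Fin n) k} {d : ℕ}
    (hf : f.IsHomogeneous d) (h : ∀ v ∈ affinePart j S, eval v f = 0) :
    S ⊆ V0 (X j) ∪ V0 f := by
  intro p hp
  obtain ⟨v, hv, rfl⟩ := exists_mk_eq p
  rw [Set.mem_union, mk_mem_V0 (isHomogeneous_X k j), mk_mem_V0 hf, eval_X, or_iff_not_imp_left]
  intro hvj
  have hw : (v j)⁻¹ • v ≠ 0 := smul_ne_zero (inv_ne_zero hvj) hv
  have hmk : Projectivization.mk k _ hw = Projectivization.mk k v hv :=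
    (Projectivization.mk_eq_mk_iff' k _ _ hw hv).2 ⟨_, rfl⟩
  rw [← mk_mem_V0 hf hv, ← hmk, mk_mem_V0 hf hw]
  exact h _ ⟨by simp [hvj], hw, hmk ▸ hp⟩

theorem subset_V0_of_affinePart {S : Set (PS k n)} (hS : IsIrreducible S) {j : Fin n}
    (hj : ¬ S ⊆ V0 (X j)) {f : MvPolynomial (Fin n) k} {d : ℕ} (hf : f.IsHomogeneous d)
    (h : ∀ v ∈ affinePart j S, eval v f = 0) : S ⊆ V0 f :=
  (isPreirreducible_iff_isClosed_union_isClosed.1 hS.isPreirreducible _ _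
    (isClosed_V0 (isHomogeneous_X k j)) (isClosed_V0 hf)
    (subset_V0_X_union hf h)).resolve_left hj

theorem isPrime_vanishingIdeal_affinePart {S : Set (PS k n)} (hS : IsIrreducible S) {j : Fin n}
    (hj : ¬ S ⊆ V0 (X j)) : (vanishingIdeal k (affinePart j S)).IsPrime := by
  refine ⟨fun h => hj ?_, fun {f g} hfg => ?_⟩
  · have h1 := (Ideal.eq_top_iff_one _).1 h
    exact subset_V0_of_affinePart hS hj (isHomogeneous_X k j) fun v hv => by
      simpa using h1 v hv
  · obtain ⟨d, F, hF, hFf⟩ := exists_homogenization j f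
    obtain ⟨e, G, hG, hGg⟩ := exists_homogenization j g
    have hFG : S ⊆ V0 (F * G) := subset_V0_of_affinePart hS hj (hF.mul hG) fun v hv => by
      have := hfg v hv
      rw [map_mul, hFf v hv.1, hGg v hv.1, ← map_mul, ← this, aeval_eq_eval]
    have hU : S ⊆ V0 F ∪ V0 G := fun p hp => by
      have := hFG hp
      obtain ⟨v, hv, rfl⟩ := exists_mk_eq p
      rw [mk_mem_V0 (hF.mul hG), map_mul, mul_eq_zero] at this
      rwa [Set.mem_union, mk_mem_V0 hF, mk_mem_V0 hG]
    refine (isPreirreducible_iff_isClosed_union_isClosed.1 hS.isPreirreducible _ _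
      (isClosed_V0 hF) (isClosed_V0 hG) hU).imp (fun h v hv => ?_) (fun h v hv => ?_)
    · rw [aeval_eq_eval, ← hFf v hv.1]
      exact eval_eq_zero_of_mem_affinePart hv h
    · rw [aeval_eq_eval, ← hGg v hv.1]
      exact eval_eq_zero_of_mem_affinePart hv h

theorem exists_not_subset_V0_X {S : Set (PS k n)} (hS : S.Nonempty) :
    ∃ j, ¬ S ⊆ V0 (X j) := by
  obtain ⟨p, hp⟩ := hS
  obtain ⟨v, hv, rfl⟩ := exists_mk_eq p
  obtain ⟨j, hj⟩ := Function.ne_iff.1 hv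
  exact ⟨j, fun h => hj (by simpa using h hp v hv rfl)⟩

theorem exists_mem_affinePart_apply_ne {S : Set (PS k n)} (hS : IsIrreducible S)
    (hnt : S.Nontrivial) {j : Fin n} (hj : ¬ S ⊆ V0 (X j)) :
    ∃ v ∈ affinePart j S, ∃ w ∈ affinePart j S, ∃ i, v i ≠ w i := by
  obtain ⟨v, hv⟩ := nonempty_of_isPrime_vanishingIdeal (isPrime_vanishingIdeal_affinePart hS hj)
  by_contra! h
  obtain ⟨q, hq, hqv⟩ := hnt.exists_ne (Projectivization.mk k v hv.2.1)
  obtain ⟨f, hf, hfv, hfq⟩ := exists_linear_separating hqv.symm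
  refine hfq (subset_V0_of_affinePart hS hj hf (fun w hw => ?_) hq)
  rw [← funext (h v hv w hw)]
  exact hfv _ _ rfl

theorem exists_isIrreducible_nontrivial {X : Set (PS k n)} (hX : ¬ pdim X ≤ 0) :
    ∃ S ⊆ X, IsIrreducible S ∧ S.Nontrivial := by
  rw [pdim, topologicalKrullDim, Order.krullDim_nonpos_iff_forall_isMax] at hX
  simp only [isMax_iff_forall_not_lt, not_forall, not_not] at hX
  obtain ⟨A, B, hAB⟩ := hX
  refine ⟨Subtype.val '' (B : Set X), by simp, B.isIrreducible.image _ (by fun_prop), ?_⟩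
  refine Set.Nontrivial.image ?_ Subtype.val_injective
  obtain ⟨a, ha⟩ := A.isIrreducible.nonempty
  obtain ⟨b, hb, hbA⟩ := Set.exists_of_ssubset hAB
  exact ⟨a, hAB.le ha, b, hb, fun h => hbA (h ▸ ha)⟩

theorem not_pdim_le_one {X Z₀ Z₁ Z₂ : Set (PS k n)} (h₀ : IsIrreducible Z₀) (h₁ : IsIrreducible Z₁)
    (h₂ : IsIrreducible Z₂) (h₀₁ : Z₀ ⊆ Z₁) (h₁₂ : Z₁ ⊆ Z₂) (hX : Z₂ ⊆ X)
    (h₁₀ : ¬ Z₁ ⊆ closure Z₀) (h₂₁ : ¬ Z₂ ⊆ closure Z₁) : ¬ pdim X ≤ 1 := by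
  have hc : ∀ {Z : Set (PS k n)}, Z ⊆ X →
      closure (Subtype.val ⁻¹' Z : Set X) = Subtype.val ⁻¹' closure Z := fun {Z} hZ => by
    rw [Topology.IsInducing.subtypeVal.closure_eq_preimage_closure_image,
      Subtype.image_preimage_coe, Set.inter_eq_right.2 hZ]
  have hirr : ∀ {Z : Set (PS k n)}, Z ⊆ X → IsIrreducible Z →
      IsIrreducible (Subtype.val ⁻¹' Z : Set X) := fun {Z} hZ h => by
    refine ⟨let ⟨p, hp⟩ := h.nonempty; ⟨⟨p, hZ hp⟩, hp⟩, fun U V hU hV => ?_⟩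
    obtain ⟨U, hU', rfl⟩ := isOpen_induced_iff.1 hU
    obtain ⟨V, hV', rfl⟩ := isOpen_induced_iff.1 hV
    rintro ⟨p, hpZ, hpU⟩ ⟨q, hqZ, hqV⟩
    obtain ⟨x, hxZ, hx⟩ := h.isPreirreducible U V hU' hV' ⟨p, hpZ, hpU⟩ ⟨q, hqZ, hqV⟩
    exact ⟨⟨x, hZ hxZ⟩, hxZ, hx⟩
  let c : ∀ Z : Set (PS k n), Z ⊆ X → IsIrreducible Z → TopologicalSpace.IrreducibleCloseds X :=
    fun Z hZ h => ⟨closure (Subtype.val ⁻¹' Z), (hirr hZ h).closure, isClosed_closure⟩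
  have hlt : ∀ {Z W : Set (PS k n)} (hZ : Z ⊆ X) (hW : W ⊆ X) (iZ : IsIrreducible Z)
      (iW : IsIrreducible W), Z ⊆ W → ¬ W ⊆ closure Z → c Z hZ iZ < c W hW iW :=
    fun {Z W} hZ hW iZ iW h h' => by
      refine lt_of_le_not_ge (closure_mono (Set.preimage_mono h)) fun hle => h' fun p hp => ?_
      have := hle (subset_closure (show (⟨p, hW hp⟩ : X) ∈ Subtype.val ⁻¹' W from hp))
      change _ ∈ closure _ at this
      rwa [hc hZ] at this
  rw [pdim, topologicalKrullDim, Order.krullDim_le_one_iff]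
  push Not
  exact ⟨c Z₁ (h₁₂.trans hX) h₁, not_isMin_of_lt
      (hlt ((h₀₁.trans h₁₂).trans hX) (h₁₂.trans hX) h₀ h₁ h₀₁ h₁₀),
    not_isMax_of_lt (hlt (h₁₂.trans hX) hX h₁ h₂ h₁₂ h₂₁)⟩

end

theorem isAlgebraic_adjoin_map {k A B : Type*} [Field k] [CommRing A] [CommRing B] [Algebra k A]
    [Algebra k B] {φ : A →ₐ[k] B} (hφ : Function.Injective φ) {z x : A}
    (hx : IsAlgebraic (Algebra.adjoin k {z}) x) : IsAlgebraic (Algebra.adjoin k {φ z}) (φ x) := by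
  have hz : ∀ y ∈ Algebra.adjoin k {z}, φ y ∈ Algebra.adjoin k {φ z} := fun y hy => by
    rw [← Set.image_singleton, ← AlgHom.map_adjoin]
    exact ⟨y, hy, rfl⟩
  let g : Algebra.adjoin k {z} →ₐ[k] Algebra.adjoin k {φ z} :=
    (φ.comp (Subalgebra.val _)).codRestrict _ fun y => hz y y.2
  exact hx.ringHom_of_comp_eq g φ (fun a b h => Subtype.ext (hφ (congrArg Subtype.val h))) rfl

section

variable {k : Type} [Field k] {n : ℕ}

/-- The points of projective space represented by the zeros of `Q`. -/
def projZeros (Q : Ideal (MvPolynomial (Fin n) k)) : Set (PS k n) :=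
  {p | ∃ v ∈ zeroLocus k Q, ∃ hv : v ≠ 0, Projectivization.mk k v hv = p}

theorem projZeros_anti {Q Q' : Ideal (MvPolynomial (Fin n) k)} (h : Q ≤ Q') :
    projZeros Q' ⊆ projZeros Q :=
  fun _ ⟨v, hv, hv'⟩ => ⟨v, fun f hf => hv f (h hf), hv'⟩

theorem apply_eq_one_of_mem_zeroLocus {Q : Ideal (MvPolynomial (Fin n) k)} {m : Fin n}
    (hm : X m - 1 ∈ Q) {v : Fin n → k} (hv : v ∈ zeroLocus k Q) : v m = 1 := by
  simpa [sub_eq_zero] using hv _ hm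

theorem ne_zero_of_mem_zeroLocus {Q : Ideal (MvPolynomial (Fin n) k)} {m : Fin n}
    (hm : X m - 1 ∈ Q) {v : Fin n → k} (hv : v ∈ zeroLocus k Q) : v ≠ 0 := fun h => by
  simpa [h] using apply_eq_one_of_mem_zeroLocus hm hv

variable [IsAlgClosed k]

theorem mem_of_forall_zeroLocus {Q : Ideal (MvPolynomial (Fin n) k)} [Q.IsPrime]
    {f : MvPolynomial (Fin n) k} (h : ∀ v ∈ zeroLocus k Q, eval v f = 0) : f ∈ Q := by
  rw [← MvPolynomial.IsPrime.vanishingIdeal_zeroLocus (K := k) Q]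
  exact fun v hv => by rw [aeval_eq_eval, h v hv]

theorem isIrreducible_projZeros {Q : Ideal (MvPolynomial (Fin n) k)} [hQ : Q.IsPrime] {m : Fin n}
    (hm : X m - 1 ∈ Q) : IsIrreducible (projZeros Q) := by
  have aux : ∀ f ∉ Q, ∃ v ∈ zeroLocus k Q, eval v f ≠ 0 := fun f hf => by
    by_contra! h
    exact hf (mem_of_forall_zeroLocus h)
  refine ⟨?_, fun U V hU hV ⟨p, ⟨v, hv, hv0, hp⟩, hpU⟩ ⟨q, ⟨w, hw, hw0, hq⟩, hqV⟩ => ?_⟩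
  · obtain ⟨v, hv, -⟩ := aux 1 fun h => hQ.ne_top ((Ideal.eq_top_iff_one _).2 h)
    exact ⟨_, v, hv, ne_zero_of_mem_zeroLocus hm hv, rfl⟩
  · obtain ⟨d, f, hf, hfp, hfU⟩ := exists_homogeneous_of_mem_isOpen hU hpU
    obtain ⟨e, g, hg, hgq, hgV⟩ := exists_homogeneous_of_mem_isOpen hV hqV
    rw [← hp, mk_mem_V0 hf] at hfp
    rw [← hq, mk_mem_V0 hg] at hgq
    obtain ⟨u, hu, huf⟩ := aux (f * g) fun h => (hQ.mem_or_mem h).elim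
      (fun h => hfp (by simpa using hv f h)) (fun h => hgq (by simpa using hw g h))
    have hu0 := ne_zero_of_mem_zeroLocus hm hu
    rw [map_mul, mul_ne_zero_iff] at huf
    refine ⟨Projectivization.mk k u hu0, ⟨u, hu, hu0, rfl⟩, hfU ?_, hgV ?_⟩
    · exact fun h => huf.1 (h u hu0 rfl)
    · exact fun h => huf.2 (h u hu0 rfl)

theorem not_projZeros_subset_closure {Q Q' : Ideal (MvPolynomial (Fin n) k)} [Q.IsPrime]
    {m : Fin n} (hm : X m - 1 ∈ Q) (h : Q < Q') : ¬ projZeros Q ⊆ closure (projZeros Q') := by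
  intro hle
  obtain ⟨g, hg', hg⟩ := Set.exists_of_ssubset h
  obtain ⟨d, G, hG, hGg⟩ := exists_homogenization m g
  have hcl : closure (projZeros Q') ⊆ V0 G := by
    refine closure_minimal ?_ (isClosed_V0 hG)
    rintro _ ⟨v, hv, hv0, rfl⟩
    rw [mk_mem_V0 hG, hGg v (apply_eq_one_of_mem_zeroLocus (h.le hm) hv)]
    simpa using hv g hg'
  refine hg (mem_of_forall_zeroLocus fun v hv => ?_)
  have hv0 := ne_zero_of_mem_zeroLocus hm hv
  rw [← hGg v (apply_eq_one_of_mem_zeroLocus hm hv)]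
  exact hcl (hle ⟨v, hv, hv0, rfl⟩) v hv0 rfl

/-- A derivation that kills a transcendental element of the field generated by a point of a
curve kills the coordinates of that point. -/
theorem derivation_eq_zero_of_pdim_le_one {L : Type} [Field L] [CharZero L] [Algebra k L]
    {Z : Set (PS k n)} (hZ : IsClosed Z) (hdim : pdim Z ≤ 1) {τ : Fin n → L} {m : Fin n}
    (hm : τ m = 1) (hτ : ∀ f ∈ homogCut Z, aeval τ f = 0) (δ : Derivation k L L) {a : L}
    (ha : a ∈ IntermediateField.adjoin k (Set.range τ)) (hta : Transcendental k a)
    (hδ : δ a = 0) (i : Fin n) : δ (τ i) = 0 := by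
  obtain ⟨Q, hQdef⟩ : ∃ Q, Q = RingHom.ker (aeval τ : MvPolynomial (Fin n) k →ₐ[k] L) := ⟨_, rfl⟩
  have hQ_mem : ∀ {f}, f ∈ Q ↔ aeval τ f = 0 := by simp [hQdef]
  have : Q.IsPrime := hQdef ▸ RingHom.ker_isPrime _
  rcases exists_isAlgebraic_adjoin_or_exists_isPrime_chain Q with ⟨z, hz⟩ | h
  · let φ : MvPolynomial (Fin n) k ⧸ Q →ₐ[k] L := Ideal.Quotient.liftₐ Q (aeval τ) fun f => hQ_mem.1
    have hφ : Function.Injective φ := (injective_iff_map_eq_zero φ).2 fun x hx => by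
      obtain ⟨f, rfl⟩ := Ideal.Quotient.mk_surjective x
      exact Ideal.Quotient.eq_zero_iff_mem.2 (hQ_mem.2 hx)
    have key : ∀ i, IsAlgebraic (Algebra.adjoin k {φ z}) (τ i) := fun i => by
      have hi : φ (Ideal.Quotient.mk Q (X i)) = τ i := aeval_X τ i
      exact hi ▸ isAlgebraic_adjoin_map hφ (hz _)
    exact Derivation.eq_zero_of_isAlgebraic_adjoin δ hδ
      (isAlgebraic_adjoin_of_forall_isAlgebraic key ha hta i)
  · obtain ⟨Q₀, Q₁, Q₂, h₀, h₁, h₂, hQ, h₀₁, h₁₂⟩ := h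
    have hmQ : X m - 1 ∈ Q := by simp [hQ_mem, hm]
    have hmQ₁ := h₀₁.le (hQ hmQ)
    refine (not_pdim_le_one (isIrreducible_projZeros (h₁₂.le hmQ₁))
      (isIrreducible_projZeros hmQ₁) (isIrreducible_projZeros (hQ hmQ))
      (projZeros_anti h₁₂.le) (projZeros_anti h₀₁.le) ?_
      (not_projZeros_subset_closure hmQ₁ h₁₂)
      (not_projZeros_subset_closure (hQ hmQ) h₀₁) hdim).elim
    rintro _ ⟨v, hv, hv0, rfl⟩
    by_contra hvZ
    obtain ⟨f, hf, hfv⟩ := exists_homogCut_of_notMem hZ hvZ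
    obtain ⟨d, hd⟩ := hf.1
    exact hfv ((mk_mem_V0 hd hv0).2 (by simpa using hv f (hQ (hQ_mem.2 (hτ f hf)))))

end

theorem exists_sum_smul_eq_zero_of_forall_det_eq_zero {L ι : Type*} [Field L] [Finite ι] {d : ℕ}
    (M : Fin d → ι → L) (h : ∀ I : Fin d → ι, (Matrix.of fun a b => M a (I b)).det = 0) :
    ∃ w : Fin d → L, w ≠ 0 ∧ ∀ i, ∑ a, w a * M a i = 0 := by
  have := Fintype.ofFinite ι
  by_contra! hw
  have hli : LinearIndependent L M := by
    rw [Fintype.linearIndependent_iff]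
    intro g hg
    by_contra! hg0
    obtain ⟨i, hi⟩ := hw g (Function.ne_iff.2 hg0)
    exact hi (by simpa using congrFun hg i)
  have hrank : (Matrix.of M).rank = d := by
    simpa using LinearIndependent.rank_matrix (M := Matrix.of M) hli
  rw [Matrix.rank_eq_finrank_span_cols] at hrank
  obtain ⟨f, hf, -, hfi⟩ := Submodule.exists_fun_fin_finrank_span_eq L
    (Set.range (Matrix.of M).col)
  choose I hI using hf
  let e := Fin.cast hrank.symm
  have hcols : LinearIndependent L (Matrix.of fun a b => M a (I (e b))).col := by
    have : (Matrix.of fun a b => M a (I (e b))).col = f ∘ e := funext fun b => hI (e b)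
    exact this ▸ hfi.comp e (Fin.cast_injective _)
  exact ((Matrix.isUnit_iff_isUnit_det _).1
    (Matrix.linearIndependent_cols_iff_isUnit.1 hcols)).ne_zero (h fun b => I (e b))

theorem exists_finrank_le_three {k : Type*} [Field k] {n : ℕ} (o o' y₁ : Fin n → k) :
    ∃ W : Submodule k (Fin n → k), Module.finrank k W ≤ 3 ∧ o ∈ W ∧ 
     ∀ y, (∀ m : Fin n → k, m ⬝ᵥ o = 0 → m ⬝ᵥ o' = 0 → m ⬝ᵥ y₁ = 0 → m ⬝ᵥ y = 0) → y ∈ W := by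
  refine ⟨Submodule.span k (Set.range ![o, o', y₁]), ?_, Submodule.subset_span ⟨0, rfl⟩,
    fun y hy => ?_⟩
  · simpa [Set.finrank] using finrank_range_le_card (R := k) ![o, o', y₁]
  · by_contra hyW
    obtain ⟨f, hf, hW⟩ := Submodule.exists_le_ker_of_notMem hyW
    have hfm : ∀ z, (fun i => f (Pi.single i 1)) ⬝ᵥ z = f z := fun z => by
      conv_rhs => rw [pi_eq_sum_univ' z]
      simp [dotProduct, mul_comm]
    have hW' : ∀ a, f (![o, o', y₁] a) = 0 := fun a => hW (Submodule.subset_span ⟨a, rfl⟩)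
    refine hf ?_
    rw [← hfm]
    refine hy _ ?_ ?_ ?_ <;> rw [hfm]
    exacts [hW' 0, hW' 1, hW' 2]

section

variable {k L : Type} [Field k] [IsAlgClosed k] [Field L] [CharZero L] [Algebra k L] {n : ℕ}

/-- Along a curve, the velocities in two directions and the position are linearly dependent. -/
theorem exists_derivation_combination {Z : Set (PS k n)} (hZ : IsClosed Z) (hdim : pdim Z ≤ 1)
    {t : Fin n → L} (ht : t ≠ 0) (htZ : ∀ f ∈ homogCut Z, aeval t f = 0)
    (δ₁ δ₂ : Derivation k L L) :
    ∃ a b c : L, (a ≠ 0 ∨ b ≠ 0) ∧ ∀ i, a * δ₁ (t i) + b * δ₂ (t i) = c * t i := by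
  obtain ⟨m, hm⟩ := Function.ne_iff.1 ht
  rw [Pi.zero_apply] at hm
  obtain ⟨τ, hτt⟩ : ∃ τ : Fin n → L, τ = (t m)⁻¹ • t := ⟨_, rfl⟩
  have htτ : ∀ i, t i = t m * τ i := fun i => by simp [hτt, hm]
  have hτm : τ m = 1 := by simp [hτt, hm]
  have hτZ : ∀ f ∈ homogCut Z, aeval τ f = 0 := fun f hf => by
    obtain ⟨d, hd⟩ := hf.1
    rw [hτt, aeval_smul_of_isHomogeneous hd, htZ f hf, mul_zero]
  obtain ⟨a, b, hab, h⟩ : ∃ a b : L, (a ≠ 0 ∨ b ≠ 0) ∧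
      ∀ i, a * δ₁ (τ i) + b * δ₂ (τ i) = 0 := by
    by_cases h₁ : ∀ i, δ₁ (τ i) = 0
    · exact ⟨1, 0, by simp, by simp [h₁]⟩
    · push Not at h₁
      obtain ⟨l, hl⟩ := h₁
      refine ⟨δ₂ (τ l), -δ₁ (τ l), by simp [hl], fun i => ?_⟩
      have := derivation_eq_zero_of_pdim_le_one hZ hdim hτm hτZ
        (δ₂ (τ l) • δ₁ - δ₁ (τ l) • δ₂) (a := τ l)
        (IntermediateField.subset_adjoin _ _ ⟨l, rfl⟩)
        (fun halg => hl (derivation_eq_zero_of_isAlgebraic δ₁ halg)) (by simp [mul_comm]) i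
      simpa [sub_eq_add_neg] using this
  refine ⟨a, b, (a * δ₁ (t m) + b * δ₂ (t m)) / t m, hab, fun i => ?_⟩
  rw [htτ i, Derivation.leibniz, Derivation.leibniz, div_mul_eq_mul_div, eq_div_iff hm]
  simp only [smul_eq_mul]
  linear_combination t m * t m * h i

theorem exists_forall_dotProduct_eq_zero {Y : Set (PS k n)} (hY : IsClosed Y)
    (hdim : pdim Y ≤ 1) {V : Set (Fin n → k)} {v : Fin n → L} {j : Fin n} (hj : v j = 1)
    (hvY : ∀ f ∈ homogCut Y, aeval v f = 0) (hvV : ∀ f, aeval v f = 0 ↔ ∀ y ∈ V, eval y f = 0)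
    (δ : Derivation k L L) {i : Fin n} (hi : δ (v i) ≠ 0) {o o' : Fin n → k} {α β γ ε : L}
    (hγε : γ ≠ 0 ∨ ε ≠ 0) (h : ∀ i, α * algebraMap k L (o i) + β * algebraMap k L (o' i) +
      γ * v i + ε * δ (v i) = 0) :
    ∃ y₁ : Fin n → k, ∀ m : Fin n → k, m ⬝ᵥ o = 0 → m ⬝ᵥ o' = 0 → m ⬝ᵥ y₁ = 0 →
      ∀ y ∈ V, m ⬝ᵥ y = 0 := by
  let F : (Fin n → k) → MvPolynomial (Fin n) k := fun m => ∑ i, C (m i) * X i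
  have hFeval : ∀ m y, eval y (F m) = m ⬝ᵥ y := fun m y => by simp [F, dotProduct]
  have hFaeval : ∀ m, aeval v (F m) = ∑ i, algebraMap k L (m i) * v i := fun m => by simp [F]
  have hFδ : ∀ m, δ (aeval v (F m)) = ∑ i, algebraMap k L (m i) * δ (v i) := fun m => by
    simp [hFaeval]
  have hrel : ∀ m : Fin n → k, m ⬝ᵥ o = 0 → m ⬝ᵥ o' = 0 →
      γ * aeval v (F m) + ε * δ (aeval v (F m)) = 0 := fun m ho ho' => by
    have ho := congrArg (algebraMap k L) ho
    have ho' := congrArg (algebraMap k L) ho'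
    simp only [dotProduct, map_sum, map_mul, map_zero] at ho ho'
    have hs : ∑ i, algebraMap k L (m i) * (α * algebraMap k L (o i) +
        β * algebraMap k L (o' i) + γ * v i + ε * δ (v i)) = 0 :=
      Finset.sum_eq_zero fun i _ => by rw [h i, mul_zero]
    rw [hFδ, hFaeval]
    calc _ = ∑ i, algebraMap k L (m i) * (α * algebraMap k L (o i) + β * algebraMap k L (o' i) +
          γ * v i + ε * δ (v i)) - α * ∑ i, algebraMap k L (m i) * algebraMap k L (o i)
          - β * ∑ i, algebraMap k L (m i) * algebraMap k L (o' i) := by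
            simp only [Finset.mul_sum, ← Finset.sum_add_distrib, ← Finset.sum_sub_distrib]
            exact Finset.sum_congr rfl fun i _ => by ring
      _ = 0 := by rw [hs, ho, ho']; ring
  by_cases hall : ∀ m : Fin n → k, m ⬝ᵥ o = 0 → m ⬝ᵥ o' = 0 → aeval v (F m) = 0
  · exact ⟨0, fun m ho ho' _ y hy => by rw [← hFeval]; exact (hvV _).1 (hall m ho ho') y hy⟩
  · push Not at hall
    obtain ⟨m₁, ho₁, ho₁', hm₁⟩ := hall
    obtain ⟨y₁, hy₁, hmy₁⟩ : ∃ y₁ ∈ V, m₁ ⬝ᵥ y₁ ≠ 0 := by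
      by_contra! h0
      exact hm₁ ((hvV _).2 fun y hy => by rw [hFeval, h0 y hy])
    refine ⟨y₁, fun m ho ho' hmy y hy => ?_⟩
    have hδq : δ (aeval v (F m) / aeval v (F m₁)) = 0 := by
      rw [Derivation.leibniz_div, smul_eq_zero, smul_eq_mul, smul_eq_mul]
      right
      rcases hγε with hγ | hε
      · refine mul_left_cancel₀ hγ ?_
        linear_combination δ (aeval v (F m)) * hrel m₁ ho₁ ho₁' -
          δ (aeval v (F m₁)) * hrel m ho ho'
      · refine mul_left_cancel₀ hε ?_
        linear_combination aeval v (F m₁) * hrel m ho ho' -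
          aeval v (F m) * hrel m₁ ho₁ ho₁'
    have hF_mem : ∀ m, aeval v (F m) ∈ IntermediateField.adjoin k (Set.range v) := fun m => by
      rw [hFaeval]
      exact sum_mem fun i _ => mul_mem (IntermediateField.algebraMap_mem _ _)
        (IntermediateField.subset_adjoin _ _ ⟨i, rfl⟩)
    obtain ⟨c, hc⟩ := exists_algebraMap_eq_of_isAlgebraic (not_not.1 fun htr => hi
      (derivation_eq_zero_of_pdim_le_one hY hdim hj hvY δ
        (div_mem (hF_mem m) (hF_mem m₁)) htr hδq i))
    rw [eq_div_iff hm₁] at hc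
    have hV : ∀ y ∈ V, m ⬝ᵥ y = c * (m₁ ⬝ᵥ y) := fun y hy => by
      have := (hvV (F m - C c * F m₁)).1 (by simp [hc]) y hy
      simpa [hFeval, sub_eq_zero] using this
    have hc0 : c = 0 := by
      simpa [hmy, hmy₁] using hV y₁ hy₁
    rw [hV y hy, hc0, zero_mul]

end

theorem eval₂_aeval_line {k R A σ : Type*} [Field k] [CommRing R] [CommRing A] [Algebra k R]
    [Algebra k A] (φ : R →+* A) (hφ : ∀ a, φ (algebraMap k R a) = algebraMap k A a) (c : A)
    (x y : σ → R) (f : MvPolynomial σ k) :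
    (aeval (fun i => Polynomial.C (x i) * Polynomial.X + Polynomial.C (y i)) f).eval₂ φ c =
      aeval (fun i => φ (x i) * c + φ (y i)) f := by
  induction f using MvPolynomial.induction_on with
  | C a => simp [← algebraMap_eq, Polynomial.algebraMap_apply, hφ]
  | add p q hp hq => simp [hp, hq]
  | mul_X p i hp => simp [hp, Polynomial.eval₂_mul]

section

variable {k : Type} [Field k] [IsAlgClosed k] {n : ℕ}

theorem exists_sum_velocity_eq_zero {L : Type} [Field L] [CharZero L] [Algebra k L]
    {T : Set (PS k n)} (hT : IsClosed T) (hdim : pdim T ≤ 1) {u v : Fin n → L}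
    {δ₁ δ₂ : Derivation k L L} (hv : ∀ i, δ₁ (v i) = 0) (hu : ∀ i, δ₂ (u i) = 0) {j : Fin n}
    (hj : u j = 1) {l : Fin n} (hl : δ₁ (u l) ≠ 0) {f : MvPolynomial (Fin n) k}
    (hf : f ∈ homogCut T) (hfv : aeval v f ≠ 0) {c : L}
    (hc : ∀ f ∈ homogCut T, aeval (fun i => u i * c + v i) f = 0) :
    ∃ w : Fin 4 → L, w ≠ 0 ∧
      ∀ i, w 0 * u i + w 1 * δ₁ (u i) + w 2 * v i + w 3 * δ₂ (v i) = 0 := by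
  have hc0 : c ≠ 0 := by
    rintro rfl
    exact hfv (by simpa using hc f hf)
  have ht : (fun i => u i * c + v i) ≠ 0 := fun h => by
    have hvi : ∀ i, v i = -(u i * c) := fun i => by
      rw [eq_neg_iff_add_eq_zero, add_comm]
      exact congrFun h i
    have hδc : δ₁ c = 0 := by
      simpa [hvi j, hj] using hv j
    exact mul_ne_zero hc0 hl (by simpa [hvi l, hδc] using hv l)
  obtain ⟨a, b, e, hab, h⟩ := exists_derivation_combination hT hdim ht hc δ₁ δ₂
  refine ⟨![a * δ₁ c + b * δ₂ c - e * c, a * c, -e, b], fun h0 => ?_, fun i => ?_⟩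
  · have h1 := congrFun h0 1
    have h3 := congrFun h0 3
    simp [hc0] at h1 h3
    exact hab.elim (· h1) (· h3)
  · have := h i
    simp only [map_add, Derivation.leibniz, hu, hv, smul_eq_mul] at this
    simp only [Matrix.cons_val]
    linear_combination this

variable [CharZero k]

theorem exists_finrank_le_three_of_collinear {Y T : Set (PS k n)} (hY : IsClosed Y)
    (hdY : pdim Y ≤ 1) (hT : IsClosed T) (hdT : pdim T ≤ 1) {V W : Set (Fin n → k)}
    (hV : (vanishingIdeal k V).IsPrime) (hW : (vanishingIdeal k W).IsPrime) {j j' : Fin n}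
    (hVj : ∀ o ∈ V, o j = 1) (hWj : ∀ y ∈ W, y j' = 1)
    (hV' : ∃ v ∈ V, ∃ w ∈ V, ∃ i, v i ≠ w i) (hW' : ∃ v ∈ W, ∃ w ∈ W, ∃ i, v i ≠ w i)
    (hWY : ∀ f ∈ homogCut Y, ∀ y ∈ W, eval y f = 0)
    (hWT : ∃ f ∈ homogCut T, ∃ y ∈ W, eval y f ≠ 0)
    (hVW : ∀ o ∈ V, ∀ y ∈ W, ∃ c : k, ∀ f ∈ homogCut T, eval (fun i => o i * c + y i) f = 0) :
    ∃ E : Submodule k (Fin n → k), Module.finrank k E ≤ 3 ∧ (∃ o ∈ V, o ∈ E) ∧ W ⊆ E := by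
  obtain ⟨o₁, ho₁, o₂, ho₂, l, hl⟩ := hV'
  obtain ⟨y₁, hy₁, y₂, hy₂, l', hl'⟩ := hW'
  obtain ⟨D₁, hD₁, hD₁l⟩ := exists_derivation_of_apply_ne hV ho₁ ho₂ hl
  obtain ⟨D₂, hD₂, hD₂l⟩ := exists_derivation_of_apply_ne hW hy₁ hy₂ hl'
  obtain ⟨L, _, _, u, v, δ₁, δ₂, huv, hδ₁u, hδ₁v, hδ₂u, hδ₂v, hroot⟩ :=
    exists_genericPoint_prod hV hW D₁ hD₁ D₂ hD₂
  have : CharZero L := charZero_of_injective_algebraMap (algebraMap k L).injective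
  have hu : ∀ f, aeval u f = 0 ↔ ∀ o ∈ V, eval o f = 0 := fun f => by
    have := huv (rename Sum.inl f)
    simp only [aeval_rename, Sum.elim_comp_inl, aeval_eq_eval] at this
    exact this.trans ⟨fun h o ho => h o ho y₁ hy₁, fun h o ho _ _ => h o ho⟩
  have hv : ∀ f, aeval v f = 0 ↔ ∀ y ∈ W, eval y f = 0 := fun f => by
    have := huv (rename Sum.inr f)
    simp only [aeval_rename, Sum.elim_comp_inr, aeval_eq_eval] at this
    exact this.trans ⟨fun h => h o₁ ho₁, fun h _ _ => h⟩
  have huj : u j = 1 := by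
    have := (hu (X j - 1)).2 fun o ho => by simp [hVj o ho]
    rwa [map_sub, aeval_X, map_one, sub_eq_zero] at this
  have hvj : v j' = 1 := by
    have := (hv (X j' - 1)).2 fun y hy => by simp [hWj y hy]
    rwa [map_sub, aeval_X, map_one, sub_eq_zero] at this
  have hδ₁l : δ₁ (u l) ≠ 0 := fun h => hD₁l fun o ho => by
    rw [aeval_eq_eval]
    exact (hu _).1 ((hδ₁u l).symm.trans h) o ho
  have hδ₂l : δ₂ (v l') ≠ 0 := fun h => hD₂l fun y hy => by
    rw [aeval_eq_eval]
    exact (hv _).1 ((hδ₂v l').symm.trans h) y hy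
  obtain ⟨c, hc⟩ : ∃ c : L, ∀ f ∈ homogCut T, aeval (fun i => u i * c + v i) f = 0 := by
    obtain ⟨c, hc⟩ := hroot ((fun f : MvPolynomial (Fin n) k => aeval (fun i =>
      Polynomial.C (X (Sum.inl i)) * Polynomial.X + Polynomial.C (X (Sum.inr i))) f) ''
        homogCut T) fun o ho y hy => by
      obtain ⟨c, hc⟩ := hVW o ho y hy
      refine ⟨c, ?_⟩
      rintro _ ⟨f, hf, rfl⟩
      rw [eval₂_aeval_line _ (by simp [algebraMap_eq])]
      simpa [aeval_eq_eval] using hc f hf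
    refine ⟨c, fun f hf => ?_⟩
    have := hc _ ⟨f, hf, rfl⟩
    rw [eval₂_aeval_line _ (by simp)] at this
    simpa using this
  obtain ⟨f, hf, y₀, hy₀, hfy⟩ := hWT
  obtain ⟨w, hw0, hw⟩ := exists_sum_velocity_eq_zero hT hdT hδ₁v hδ₂u huj hδ₁l hf
    (fun h => hfy ((hv f).1 h y₀ hy₀)) hc
  let P : Fin 4 → Fin n → MvPolynomial (Fin n ⊕ Fin n) k := ![fun i => X (Sum.inl i),
    fun i => rename Sum.inl (D₁ (X i)), fun i => X (Sum.inr i),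
    fun i => rename Sum.inr (D₂ (X i))]
  have hdet : ∀ I : Fin 4 → Fin n, ∀ o ∈ V, ∀ y ∈ W,
      aeval (Sum.elim o y) (Matrix.of fun a b => P a (I b)).det = 0 := fun I => by
    rw [← huv, AlgHom.map_det, ← Matrix.exists_vecMul_eq_zero_iff]
    refine ⟨w, hw0, funext fun b => ?_⟩
    have := hw (I b)
    rw [hδ₁u, hδ₂v] at this
    simpa [Matrix.vecMul, dotProduct, Fin.sum_univ_four, P, aeval_rename] using this
  obtain ⟨o, ho, hol⟩ : ∃ o ∈ V, eval o (D₁ (X l)) ≠ 0 := by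
    by_contra! h
    exact hD₁l fun o ho => by rw [aeval_eq_eval, h o ho]
  obtain ⟨w', hw'0, hw'⟩ := exists_sum_smul_eq_zero_of_forall_det_eq_zero
    (fun a i => aeval (Sum.elim (fun i => algebraMap k L (o i)) v) (P a i)) fun I => by
      have := (hv (aeval (Sum.elim (fun i => C (o i)) X) (Matrix.of fun a b => P a (I b)).det)).2
        fun y hy => by
          rw [← aeval_eq_eval, aeval_aeval_sumElim_left]
          exact hdet I o ho y hy
      rwa [aeval_aeval_sumElim_algebraMap, AlgHom.map_det] at this
  simp only [Fin.sum_univ_four] at hw'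
  have hrel : ∀ i, w' 0 * algebraMap k L (o i) + w' 1 * algebraMap k L (eval o (D₁ (X i))) +
      w' 2 * v i + w' 3 * δ₂ (v i) = 0 := fun i => by
    have := hw' i
    have ho : (fun i => algebraMap k L (o i)) = algebraMap k L ∘ o := rfl
    simp only [P, Matrix.cons_val, aeval_X, aeval_rename, Sum.elim_comp_inl, Sum.elim_comp_inr,
      Sum.elim_inl, Sum.elim_inr, ho, aeval_algebraMap_apply, aeval_eq_eval] at this
    rwa [hδ₂v]
  have hDj : eval o (D₁ (X j)) = 0 := by
    have := hD₁ (X j - 1) fun o ho => by simp [hVj o ho]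
    rw [map_sub, Derivation.map_one_eq_zero, sub_zero] at this
    rw [← aeval_eq_eval]
    exact this o ho
  have hw'23 : w' 2 ≠ 0 ∨ w' 3 ≠ 0 := by
    by_contra! h
    have h0 : w' 0 = 0 := by simpa [h.1, h.2, hDj, hVj o ho] using hrel j
    have h1 : w' 1 = 0 := by simpa [h.1, h.2, h0, hol] using hrel l
    exact hw'0 (funext fun a => by fin_cases a <;> simp [h.1, h.2, h0, h1])
  obtain ⟨z, hz⟩ := exists_forall_dotProduct_eq_zero hY hdY hvj
    (fun f hf => (hv f).2 (hWY f hf)) hv δ₂ hδ₂l hw'23 hrel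
  obtain ⟨E, hE, hoE, hWE⟩ := exists_finrank_le_three o (fun i => eval o (D₁ (X i))) z
  exact ⟨E, hE, ⟨o, ho, hoE⟩, fun y hy => hWE y fun m h h' h'' => hz m h h' h'' y hy⟩

end

section

variable {k : Type} [Field k] {n : ℕ}

theorem nontrivial_of_pdim_eq_one {X : Set (PS k n)} (hX : pdim X = 1) : X.Nontrivial := by
  obtain ⟨S, hSX, -, hS⟩ := exists_isIrreducible_nontrivial (X := X) (by simp [hX])
  exact hS.mono hSX

theorem not_subset_of_isVariety {Y T : Set (PS k n)} (hY : IsVariety Y) (hT : IsVariety T)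
    (hYT : Y ≠ T) (hY' : Y.Nontrivial) (hdT : pdim T ≤ 1) : ¬ Y ⊆ T := fun h => by
  obtain ⟨p, hp, q, hq, hpq⟩ := hY'
  obtain ⟨f, hf, hpf, hqf⟩ := exists_linear_separating hpq
  refine not_pdim_le_one isIrreducible_singleton hY.2 hT.2 (Set.singleton_subset_iff.2 hp) h
    subset_rfl (fun hle => hqf ?_) (fun hle => hYT ?_) hdT
  · exact closure_minimal (Set.singleton_subset_iff.2 hpf) (isClosed_V0 hf) (hle hq)
  · rw [hY.1.closure_eq] at hle
    exact h.antisymm hle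

theorem submodule_le_of_affinePart {S : Set (PS k n)} (hS : IsIrreducible S) {j : Fin n}
    (hj : ¬ S ⊆ V0 (X j)) {E : Submodule k (Fin n → k)} (hE : affinePart j S ⊆ E) {p : PS k n}
    (hp : p ∈ S) : p.submodule ≤ E := by
  obtain ⟨v, hv, rfl⟩ := exists_mk_eq p
  rw [Projectivization.submodule_mk, Submodule.span_singleton_le_iff_mem]
  by_contra hvE
  obtain ⟨g, hgv, hgE⟩ := Submodule.exists_le_ker_of_notMem hvE
  have hF : (∑ i, C (g (Pi.single i 1)) * X i : MvPolynomial (Fin n) k).IsHomogeneous 1 :=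
    IsHomogeneous.sum _ _ _ fun i _ => (isHomogeneous_X k i).C_mul _
  have hFg : ∀ z, eval z (∑ i, C (g (Pi.single i 1)) * X i) = g z := fun z => by
    conv_rhs => rw [pi_eq_sum_univ' z]
    simp [mul_comm]
  exact hgv (hFg v ▸ subset_V0_of_affinePart hS hj hF (fun w hw => by
    rw [hFg]; exact hgE (hE hw)) hp v hv rfl)

theorem exists_eval_line_eq_zero {Y T : Set (PS k n)} {o y : Fin n → k} (ho : o ≠ 0) (hy : y ≠ 0)
    (hYT : projLE (Projectivization.mk k o ho) Y T) (hyY : Projectivization.mk k y hy ∈ Y)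
    (hyo : Projectivization.mk k y hy ≠ Projectivization.mk k o ho) :
    ∃ c : k, ∀ f ∈ homogCut T, eval (fun i => o i * c + y i) f = 0 := by
  obtain ⟨t, ht, hyt⟩ := hYT _ hyY hyo
  obtain ⟨t, ht0, rfl⟩ := exists_mk_eq t
  rw [Projectivization.submodule_mk, Projectivization.submodule_mk, Projectivization.submodule_mk,
    Submodule.span_singleton_le_iff_mem, Submodule.mem_sup] at hyt
  obtain ⟨_, hx, _, hz, rfl⟩ := hyt
  obtain ⟨a, rfl⟩ := Submodule.mem_span_singleton.1 hx
  obtain ⟨b, rfl⟩ := Submodule.mem_span_singleton.1 hz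
  refine ⟨-a, fun f hf => ?_⟩
  obtain ⟨d, hd⟩ := hf.1
  have : (fun i => o i * -a + (a • o + b • t) i) = b • t := by
    ext i
    simp [mul_comm]
  rw [this, ← aeval_eq_eval, aeval_smul_of_isHomogeneous hd, aeval_eq_eval, hf.2 ht t ht0 rfl,
    mul_zero]

/-- The Segre points of a pair of distinct curves spanning a space of dimension at least three
contain no curve. -/
theorem pdim_segrePtPair_le_zero [IsAlgClosed k] [CharZero k] (hn : 4 ≤ n) {Y T : Set (PS k n)}
    (hY : IsVariety Y) (hT : IsVariety T) (hYT : Y ≠ T) (hdY : pdim Y = 1) (hdT : pdim T = 1)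
    (hspan : Nondeg (Y ∪ T)) : pdim {o | SegrePtPair Y T o} ≤ 0 := by
  by_contra hpos
  obtain ⟨S, hS, hSirr, hSnt⟩ := exists_isIrreducible_nontrivial hpos
  have hYnt := nontrivial_of_pdim_eq_one hdY
  obtain ⟨j, hj⟩ := exists_not_subset_V0_X hSnt.nonempty
  obtain ⟨j', hj'⟩ := exists_not_subset_V0_X hYnt.nonempty
  obtain ⟨p, hpY, hpT⟩ := Set.not_subset.1 (not_subset_of_isVariety hY hT hYT hYnt hdT.le)
  obtain ⟨f, hf, hpf⟩ := exists_homogCut_of_notMem hT.1 hpT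
  obtain ⟨E, hE, ⟨o, ⟨-, ho, hoS⟩, hoE⟩, hYE⟩ := exists_finrank_le_three_of_collinear hY.1 hdY.le
    hT.1 hdT.le (isPrime_vanishingIdeal_affinePart hSirr hj)
    (isPrime_vanishingIdeal_affinePart hY.2 hj') (fun _ h => h.1) (fun _ h => h.1)
    (exists_mem_affinePart_apply_ne hSirr hSnt hj) (exists_mem_affinePart_apply_ne hY.2 hYnt hj')
    (fun f hf y hy => eval_eq_zero_of_mem_affinePart hy hf.2)
    ⟨f, hf, by
      by_contra! h
      obtain ⟨d, hd⟩ := hf.1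
      exact hpf (subset_V0_of_affinePart hY.2 hj' hd h hpY)⟩
    (fun o ⟨_, ho, hoS⟩ y ⟨_, hy, hyY⟩ => exists_eval_line_eq_zero ho hy (hS hoS).2.1 hyY
      fun h => (hS hoS).1 (Or.inl (h ▸ hyY)))
  have hYE' : ∀ y ∈ Y, y.submodule ≤ E := fun y => submodule_le_of_affinePart hY.2 hj' hYE
  have htop : E = ⊤ := top_le_iff.1 <| hspan.symm.trans_le <| iSup₂_le fun q hq => by
    rcases hq with hq | hq
    · exact hYE' q hq
    · obtain ⟨y, hy, hqy⟩ := (hS hoS).2.2 q hq fun h => (hS hoS).1 (Or.inr (h ▸ hq))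
      refine hqy.trans (sup_le ?_ (hYE' y hy))
      rwa [Projectivization.submodule_mk, Submodule.span_singleton_le_iff_mem]
  rw [htop, finrank_top, Module.finrank_fin_fun] at hE
  omega

end

end EL

open EL in
/-- For distinct integral curves `Y, T ⊂ ℙ^r` (`r ≥ 3`) with
`⟨Y ∪ T⟩ = ℙ^r`, the set of Segre points of the pair has dimension at most 1; if it has
dimension 1 then `deg Y = deg T`, every one-dimensional irreducible component `D` of its
closure has the same degree, and `Y`, `T`, `D` are pairwise birational. -/
theorem statement3 {k : Type} [Field k] [IsAlgClosed k] [CharZero k]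
    (r : ℕ) (hr : 3 ≤ r) (Y T : Set (PS k (r+1)))
    (hY : IsVariety Y) (hT : IsVariety T) (hYT : Y ≠ T)
    (hdY : pdim Y = 1) (hdT : pdim T = 1) (hspan : Nondeg (Y ∪ T)) :
    pdim {o | SegrePtPair Y T o} ≤ 1 ∧
    (pdim {o | SegrePtPair Y T o} = 1 →
      ∃ d : ℕ, HasDegree Y 1 d ∧ HasDegree T 1 d ∧ Birational Y T ∧
        ∀ D : Set (PS k (r+1)),
          Maximal (fun Z => Z ⊆ closure {o | SegrePtPair Y T o} ∧ IsIrreducible Z) D →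
          pdim D = 1 →
          HasDegree D 1 d ∧ Birational D Y ∧ Birational D T) := by
  have h := pdim_segrePtPair_le_zero (by omega) hY hT hYT hdY hdT hspan
  refine ⟨h.trans zero_le_one, fun h1 => ?_⟩
  rw [h1] at h
  exact absurd h (by simp)
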